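/- Suppose (A1)-(A3) hold, set Λ = Λ(M), and let x_n ∈ ℤ_+^{Λ,d} be a sequence with |x_n| → ∞ and x_n/|x_n| → M/|M| which is fundamental for the local Markov-additive process (Z_Λ(t)). Then there is a strictly positive harmonic function f of the induced Markov chain X_M such that for every x ∈ ℤ_+^{Λ,d}, lim_{n→∞} G_Λ(x, x_n)/G_Λ(x_0, x_n) = f(x^Λ)/f(x_0^Λ). -/

import Mathlib

open Filter Topology

attribute [local instance] Classical.propDecidable

noncomputable section

variable {V : Type*} [AddCommGroup V]

/-- `n`-step transition kernel of the random walk with step distribution `μ`,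
killed upon leaving the set `A` : `kern μ A n x y = P_x(S n = y, τ_A > n)`,
where `τ_A` is the first exit time from `A`. -/
def kern (μ : V → ℝ) (A : Set V) : ℕ → V → V → ℝ
  | 0 => fun x y => if x = y ∧ x ∈ A then 1 else 0
  | n + 1 => fun x y => ∑' z : V, (if x ∈ A then μ (z - x) else 0) * kern μ A n z y

/-- Green function of the walk killed outside `A`. -/
def green (μ : V → ℝ) (A : Set V) (x y : V) : ℝ :=
  ∑' n : ℕ, kern μ A n x y

/-- `E_x [ g(S τ) ; S τ ∈ B, τ < ∞ ]`, where `τ` is the first exit time from `A`. -/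
def exitExp (μ : V → ℝ) (A B : Set V) (g : V → ℝ) (x : V) : ℝ :=
  ∑' n : ℕ, ∑' z : V, kern μ A n x z *
    ∑' y : V, (if y ∉ A ∧ y ∈ B then μ (y - z) else 0) * g y

/-- `ℝ≥0∞`-valued version of `exitExp`. -/
def exitExpE (μ : V → ℝ) (A B : Set V) (g : V → ℝ) (x : V) : ENNReal :=
  ∑' n : ℕ, ∑' z : V, ENNReal.ofReal (kern μ A n x z) *
    ∑' y : V, ENNReal.ofReal ((if y ∉ A ∧ y ∈ B then μ (y - z) else 0) * g y)

/-- `P_x(S t = y for some t ≥ 0)` for the walk killed outside `A`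
(first passage decomposition). -/
def hitProb (μ : V → ℝ) (A : Set V) (x y : V) : ℝ :=
  (if x = y ∧ x ∈ A then 1 else 0) +
    ∑' n : ℕ, ∑' z : V, kern μ (A \ {y}) n x z * (if y ∈ A then μ (y - z) else 0)

/-- `h` is (strictly speaking, satisfies the mean value property of a) harmonic
function on `A` for the walk with step distribution `μ` killed outside `A`. -/
def HarmOn (μ : V → ℝ) (A : Set V) (h : V → ℝ) : Prop :=
  ∀ x ∈ A, h x = ∑' y : V, if y ∈ A then μ (y - x) * h y else 0

/-- Irreducibility of the walk killed outside `A`. -/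
def Irred (μ : V → ℝ) (A : Set V) : Prop :=
  ∀ x ∈ A, ∀ x' ∈ A, ∃ (k : ℕ) (c : ℕ → V), c 0 = x ∧ c k = x' ∧
    (∀ j ≤ k, c j ∈ A) ∧ ∀ j < k, 0 < μ (c (j + 1) - c j)

/-- A sequence `xs` is fundamental for the walk killed outside `A` :
the Martin kernels `G(x, xs n)/G(x₀, xs n)` converge for every `x ∈ A`. -/
def Fundamental (μ : V → ℝ) (A : Set V) (x₀ : V) (xs : ℕ → V) : Prop :=
  ∀ x ∈ A, ∃ L : ℝ,
    Tendsto (fun n => green μ A x (xs n) / green μ A x₀ (xs n)) atTop (𝓝 L)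

/-- ℓ¹-norm of an integer vector. -/
def znorm {ι : Type*} [Fintype ι] (x : ι → ℤ) : ℝ := ∑ i, |(x i : ℝ)|

/-- ℓ¹-norm of a real vector. -/
def rnorm {ι : Type*} [Fintype ι] (q : ι → ℝ) : ℝ := ∑ i, |q i|

variable {d : ℕ}

/-- `ℤ^{Λ,d}_+ = {x ∈ ℤ^d : xⁱ > 0 for all i ∈ Λ}`. -/
def posDom (Λ : Set (Fin d)) : Set (Fin d → ℤ) := {x | ∀ i ∈ Λ, 0 < x i}

/-- `ℤ^d_+ = {x ∈ ℤ^d : xⁱ > 0 for all i}`. -/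
def posAll : Set (Fin d → ℤ) := {x | ∀ i, 0 < x i}

/-- `a · z` for `a ∈ ℝ^d`, `z ∈ ℤ^d`. -/
def dotZ (a : Fin d → ℝ) (z : Fin d → ℤ) : ℝ := ∑ i, a i * (z i : ℝ)

/-- `a · q` for `a, q ∈ ℝ^d`. -/
def dotR (a q : Fin d → ℝ) : ℝ := ∑ i, a i * q i

/-- jump generating function `φ(a) = Σ_z μ(z) exp(a·z)` (valued in `ℝ≥0∞`). -/
def phiE (μ : (Fin d → ℤ) → ℝ) (a : Fin d → ℝ) : ENNReal :=
  ∑' z : Fin d → ℤ, ENNReal.ofReal (μ z * Real.exp (dotZ a z))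

/-- `D = {a ∈ ℝ^d : φ(a) ≤ 1}`. -/
def Dset (μ : (Fin d → ℤ) → ℝ) : Set (Fin d → ℝ) := {a | phiE μ a ≤ 1}

/-- mean vector `M = Σ_z μ(z) z`. -/
def Mvec (μ : (Fin d → ℤ) → ℝ) : Fin d → ℝ := fun i => ∑' z : Fin d → ℤ, μ z * (z i : ℝ)

/-- `Λ(M) = {i : Mⁱ = 0}`. -/
def LambdaM (μ : (Fin d → ℤ) → ℝ) : Set (Fin d) := {i | Mvec μ i = 0}

/-- Assumption (A1) : irreducibility on every `ℤ^{Λ,d}_+`. -/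
def A1 (μ : (Fin d → ℤ) → ℝ) : Prop := ∀ Λ : Set (Fin d), Irred μ (posDom Λ)

/-- Assumption (A2) : `φ` is finite on a neighborhood of the set `D`. -/
def A2 (μ : (Fin d → ℤ) → ℝ) : Prop :=
  ∃ U : Set (Fin d → ℝ), IsOpen U ∧ Dset μ ⊆ U ∧ ∀ a ∈ U, phiE μ a ≠ ⊤

/-- Assumption (A3) : `M ≠ 0`. -/
def A3 (μ : (Fin d → ℤ) → ℝ) : Prop := Mvec μ ≠ 0

/-- projection `x ↦ x^Λ`. -/
def projL (Λ : Set (Fin d)) (x : Fin d → ℤ) : ↥Λ → ℤ := fun i => x (i : Fin d)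

/-- jump distribution `μ_Λ(v) = Σ_{x : x^Λ = v} μ(x)` of the projected walk. -/
def muL (μ : (Fin d → ℤ) → ℝ) (Λ : Set (Fin d)) (v : ↥Λ → ℤ) : ℝ :=
  ∑' x : Fin d → ℤ, if projL Λ x = v then μ x else 0

/-- `ℤ^Λ_+`. -/
def posL (Λ : Set (Fin d)) : Set (↥Λ → ℤ) := {u | ∀ i, 0 < u i}

end

open scoped ENNReal

noncomputable section

section Kernel

variable {V : Type*} [AddCommGroup V]

/-- `ℝ≥0∞`-valued version of `kern`. -/
def kernE (m : V → ℝ≥0∞) (A : Set V) : ℕ → V → V → ℝ≥0∞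
  | 0 => fun x y => if x = y ∧ x ∈ A then 1 else 0
  | n + 1 => fun x y => ∑' z : V, (if x ∈ A then m (z - x) else 0) * kernE m A n z y

/-- `ℝ≥0∞`-valued version of `green`. -/
def greenE (m : V → ℝ≥0∞) (A : Set V) (x y : V) : ℝ≥0∞ := ∑' n, kernE m A n x y

/-- Supremum over all times of the transition probabilities of the killed walk. -/
def reachE (m : V → ℝ≥0∞) (A : Set V) (x y : V) : ℝ≥0∞ := ⨆ n, kernE m A n x y

variable {m : V → ℝ≥0∞} {A : Set V}

lemma kernE_succ_of_mem {x : V} (hx : x ∈ A) (n : ℕ) (y : V) :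
    kernE m A (n + 1) x y = ∑' z, m (z - x) * kernE m A n z y := by
  simp [kernE, hx]

lemma kernE_left_notMem {x : V} (hx : x ∉ A) (n : ℕ) (y : V) : kernE m A n x y = 0 := by
  cases n <;> simp [kernE, hx]

lemma kernE_right_notMem {y : V} (hy : y ∉ A) (n : ℕ) (x : V) : kernE m A n x y = 0 := by
  induction n generalizing x with
  | zero =>
    simp only [kernE, ite_eq_right_iff, and_imp]
    rintro rfl h
    exact absurd h hy
  | succ n ih => simp [kernE, ih]

lemma kernE_zero_self {x : V} (hx : x ∈ A) : kernE m A 0 x x = 1 := by simp [kernE, hx]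

lemma kernE_add (a b : ℕ) (x y : V) :
    kernE m A (a + b) x y = ∑' z, kernE m A a x z * kernE m A b z y := by
  induction a generalizing x with
  | zero =>
    rw [tsum_eq_single x]
    · by_cases hx : x ∈ A
      · simp [kernE, hx]
      · simp [kernE_left_notMem hx]
    · intro z hz
      simp [kernE, hz.symm]
  | succ a ih =>
    rw [Nat.add_right_comm]
    simp only [kernE, ih]
    simp_rw [← ENNReal.tsum_mul_left, ← ENNReal.tsum_mul_right]
    rw [ENNReal.tsum_comm]
    simp_rw [mul_assoc]

lemma kernE_mul_le (a b : ℕ) (x y z : V) :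
    kernE m A a x y * kernE m A b y z ≤ kernE m A (a + b) x z := by
  rw [kernE_add]
  exact ENNReal.le_tsum y

lemma kernE_le_shift {v : V} (hv : ∀ x ∈ A, x + v ∈ A) (n : ℕ) (x y : V) :
    kernE m A n x y ≤ kernE m A n (x + v) (y + v) := by
  induction n generalizing x with
  | zero =>
    simp only [kernE, add_left_inj]
    split_ifs with h h' h'
    · exact le_rfl
    · exact absurd ⟨h.1, hv _ h.2⟩ h'
    · exact zero_le
    · exact le_rfl
  | succ n ih =>
    by_cases hx : x ∈ A
    · rw [kernE_succ_of_mem hx, kernE_succ_of_mem (hv x hx),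
        ← (Equiv.addRight v).tsum_eq (fun z => m (z - (x + v)) * kernE m A n z (y + v))]
      refine ENNReal.tsum_le_tsum fun z => ?_
      simp only [Equiv.coe_addRight, add_sub_add_right_eq_sub]
      gcongr
      exact ih z
    · simp [kernE_left_notMem hx]

lemma kernE_shift {v : V} (hv : ∀ x, x + v ∈ A ↔ x ∈ A) (n : ℕ) (x y : V) :
    kernE m A n (x + v) (y + v) = kernE m A n x y := by
  refine le_antisymm ?_ (kernE_le_shift (fun x hx => (hv x).2 hx) n x y)
  have h := kernE_le_shift (m := m) (A := A) (v := -v)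
    (fun x hx => (hv _).1 (by simpa using hx)) n (x + v) (y + v)
  simpa using h

lemma reachE_mul_le (x y z : V) :
    reachE m A x y * reachE m A y z ≤ reachE m A x z := by
  unfold reachE
  rw [ENNReal.iSup_mul]
  refine iSup_le fun a => ?_
  rw [ENNReal.mul_iSup]
  exact iSup_le fun b => (kernE_mul_le a b x y z).trans (le_iSup (fun n => kernE m A n x z) _)

lemma kernE_le_reachE (n : ℕ) (x y : V) : kernE m A n x y ≤ reachE m A x y :=
  le_iSup (fun n => kernE m A n x y) n

lemma reachE_self {x : V} (hx : x ∈ A) : 1 ≤ reachE m A x x :=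
  (kernE_zero_self hx).symm.le.trans (kernE_le_reachE 0 x x)

lemma reachE_le_shift {v : V} (hv : ∀ x ∈ A, x + v ∈ A) (x y : V) :
    reachE m A x y ≤ reachE m A (x + v) (y + v) :=
  iSup_mono fun n => kernE_le_shift hv n x y

lemma reachE_le_greenE (x y : V) : reachE m A x y ≤ greenE m A x y :=
  iSup_le fun n => ENNReal.le_tsum n

lemma reachE_mul_greenE_le (x y z : V) :
    reachE m A x y * greenE m A y z ≤ greenE m A x z := by
  unfold reachE greenE
  rw [ENNReal.iSup_mul]
  refine iSup_le fun a => ?_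
  rw [← ENNReal.tsum_mul_left]
  calc ∑' n, kernE m A a x y * kernE m A n y z
      ≤ ∑' n, kernE m A (a + n) x z := ENNReal.tsum_le_tsum fun n => kernE_mul_le a n x y z
    _ ≤ ∑' n, kernE m A n x z :=
        ENNReal.tsum_comp_le_tsum_of_injective (add_right_injective a) _

lemma greenE_eq {x : V} (hx : x ∈ A) {y : V} (hxy : x ≠ y) :
    greenE m A x y = ∑' z, m (z - x) * greenE m A z y := by
  unfold greenE
  rw [tsum_eq_zero_add' ENNReal.summable]
  simp_rw [kernE_succ_of_mem hx, ← ENNReal.tsum_mul_left]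
  rw [ENNReal.tsum_comm]
  simp [kernE, hxy]

lemma kernE_pos_of_chain (k : ℕ) (c : ℕ → V) (hc : ∀ j ≤ k, c j ∈ A)
    (hpos : ∀ j < k, 0 < m (c (j + 1) - c j)) : 0 < kernE m A k (c 0) (c k) := by
  induction k generalizing c with
  | zero => simp [kernE, hc 0 le_rfl]
  | succ k ih =>
    rw [kernE_succ_of_mem (hc 0 (Nat.zero_le _))]
    have h := ih (fun j => c (j + 1)) (fun j hj => hc _ (by omega)) (fun j hj => hpos _ (by omega))
    exact (ENNReal.mul_pos (hpos 0 (by omega)).ne' h.ne').trans_le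
      (ENNReal.le_tsum (f := fun z => m (z - c 0) * kernE m A k z (c (k + 1))) (c 1))

end Kernel

section Real

variable {V : Type*} [AddCommGroup V] {μ : V → ℝ} {A : Set V}

lemma kernE_le_one (h1 : ∑' z, ENNReal.ofReal (μ z) ≤ 1) (n : ℕ) (x y : V) :
    kernE (fun z => ENNReal.ofReal (μ z)) A n x y ≤ 1 := by
  induction n generalizing x with
  | zero => simp only [kernE]; split_ifs <;> simp
  | succ n ih =>
    by_cases hx : x ∈ A
    · rw [kernE_succ_of_mem hx]
      calc _ ≤ ∑' z, ENNReal.ofReal (μ (z - x)) :=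
            ENNReal.tsum_le_tsum fun z => mul_le_of_le_one_right zero_le (ih z)
        _ = ∑' z, ENNReal.ofReal (μ z) :=
            (Equiv.subRight x).tsum_eq (fun z => ENNReal.ofReal (μ z))
        _ ≤ 1 := h1
    · simp [kernE_left_notMem hx]

lemma kern_eq_toReal (hnn : ∀ z, 0 ≤ μ z) (h1 : ∑' z, ENNReal.ofReal (μ z) ≤ 1) (n : ℕ)
    (x y : V) : kern μ A n x y = (kernE (fun z => ENNReal.ofReal (μ z)) A n x y).toReal := by
  induction n generalizing x with
  | zero => simp only [kern, kernE]; split_ifs <;> simp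
  | succ n ih =>
    simp only [kern, kernE, ih]
    rw [ENNReal.tsum_toReal_eq]
    · congr 1
      ext z
      split_ifs
      · rw [ENNReal.toReal_mul, ENNReal.toReal_ofReal (hnn _)]
      · simp
    · intro z
      refine ENNReal.mul_ne_top ?_ ((kernE_le_one h1 n z y).trans_lt ENNReal.one_lt_top).ne
      split_ifs <;> simp

lemma green_eq_toReal (hnn : ∀ z, 0 ≤ μ z) (h1 : ∑' z, ENNReal.ofReal (μ z) ≤ 1) (x y : V) :
    green μ A x y = (greenE (fun z => ENNReal.ofReal (μ z)) A x y).toReal := by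
  unfold green greenE
  rw [ENNReal.tsum_toReal_eq fun n =>
    ((kernE_le_one h1 n x y).trans_lt ENNReal.one_lt_top).ne]
  simp_rw [kern_eq_toReal hnn h1]

end Real

section Ratio

/-- The operator on functions with values in `ℝ≥0∞` attached to a kernel. -/
def kernelOp {X : Type*} (K : X → X → ℝ≥0∞) : Module.End ℝ≥0∞ (X → ℝ≥0∞) where
  toFun f x := ∑' y, K x y * f y
  map_add' f g := by
    ext x
    simp [mul_add, ENNReal.tsum_add]
  map_smul' c f := by
    ext x
    simp only [Pi.smul_apply, smul_eq_mul, RingHom.id_apply, ← ENNReal.tsum_mul_left]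
    exact tsum_congr fun y => by ring

lemma kernelOp_apply {X : Type*} (K : X → X → ℝ≥0∞) (f : X → ℝ≥0∞) (x : X) :
    kernelOp K f x = ∑' y, K x y * f y := rfl

lemma end_mono {X : Type*} (B : Module.End ℝ≥0∞ (X → ℝ≥0∞)) {f g : X → ℝ≥0∞} (h : f ≤ g) :
    B f ≤ B g := by
  have : g = f + (g - f) := (add_tsub_cancel_of_le h).symm
  rw [this, map_add]
  exact le_self_add

lemma pow_apply_le {X : Type*} (B : Module.End ℝ≥0∞ (X → ℝ≥0∞)) {e f : X → ℝ≥0∞}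
    {r c : ℝ≥0∞} (he : B e ≤ r • e) (hf : f ≤ c • e) (n : ℕ) :
    (B ^ n) f ≤ (r ^ n * c) • e := by
  induction n with
  | zero => simpa using hf
  | succ n ih =>
    rw [pow_succ', Module.End.mul_apply]
    refine (end_mono B ih).trans ?_
    rw [map_smul]
    intro x
    have := he x
    simp only [Pi.smul_apply, smul_eq_mul] at this ⊢
    calc r ^ n * c * (B e) x ≤ r ^ n * c * (r * e x) := by gcongr
      _ = _ := by ring

lemma choose_le_add {p s : ℝ} (hp : 0 < p) (hs : 1 < s) (m j : ℕ) :
    (m.choose j : ℝ) ≤ p * ((m + 1).choose (j + 1) : ℝ)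
      + s ^ (1 - p) * (s ^ (-p)) ^ m * s ^ j * (m.choose j : ℝ) := by
  have hs0 : 0 < s := by linarith
  have hid : ((m : ℝ) + 1) * m.choose j = (m + 1).choose (j + 1) * ((j : ℝ) + 1) := by
    exact_mod_cast Nat.add_one_mul_choose_eq m j
  have hc : (0 : ℝ) ≤ m.choose j := by positivity
  have hc' : (0 : ℝ) ≤ (m + 1).choose (j + 1) := by positivity
  rcases le_or_gt ((j : ℝ) + 1) (p * (m + 1)) with h | h
  · have : (m.choose j : ℝ) ≤ p * ((m + 1).choose (j + 1) : ℝ) := by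
      have hj : (0 : ℝ) < j + 1 := by positivity
      have : (m.choose j : ℝ) * (j + 1) ≤ (p * ((m + 1).choose (j + 1) : ℝ)) * (j + 1) := by
        calc (m.choose j : ℝ) * (j + 1) ≤ m.choose j * (p * (m + 1)) := by gcongr
          _ = p * (((m : ℝ) + 1) * m.choose j) := by ring
          _ = _ := by rw [hid]; ring
      exact le_of_mul_le_mul_right this hj
    have h2 : 0 ≤ s ^ (1 - p) * (s ^ (-p)) ^ m * s ^ j * (m.choose j : ℝ) := by positivity
    linarith
  · have : 1 ≤ s ^ (1 - p) * (s ^ (-p)) ^ m * s ^ j := by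
      rw [← Real.rpow_natCast, ← Real.rpow_mul hs0.le, ← Real.rpow_natCast, ← Real.rpow_add hs0,
        ← Real.rpow_add hs0]
      apply Real.one_le_rpow hs.le
      nlinarith
    have h2 := mul_le_mul_of_nonneg_right this hc
    have h3 : 0 ≤ p * ((m + 1).choose (j + 1) : ℝ) := by positivity
    linarith

lemma end_mul_pow_le {X : Type*} {Q Y : Module.End ℝ≥0∞ (X → ℝ≥0∞)} (hQY : Commute Y Q)
    {p s : ℝ} (hp : 0 < p) (hs : 1 < s) (m : ℕ) (f : X → ℝ≥0∞) (x : X) :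
    (Y * (Y + Q) ^ m) f x ≤ ENNReal.ofReal p * ((Y + Q) ^ (m + 1)) f x
      + ENNReal.ofReal (s ^ (1 - p)) *
        (Y * (ENNReal.ofReal (s ^ (-p)) • (ENNReal.ofReal s • Y + Q)) ^ m) f x := by
  have hs0 : 0 < s := by linarith
  set t : ℕ → ℝ≥0∞ := fun j => (Y ^ (j + 1) * Q ^ (m - j)) f x with ht
  have h1 : (Y * (Y + Q) ^ m) f x = ∑ j ∈ Finset.range (m + 1), (m.choose j : ℝ≥0∞) * t j := by
    rw [hQY.add_pow, Finset.mul_sum]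
    simp only [LinearMap.sum_apply, Finset.sum_apply]
    refine Finset.sum_congr rfl fun j _ => ?_
    rw [← mul_assoc, ← mul_assoc, ← pow_succ', ← nsmul_eq_mul', ht]
    simp
  have h2 : ∑ j ∈ Finset.range (m + 1), ((m + 1).choose (j + 1) : ℝ≥0∞) * t j
      ≤ ((Y + Q) ^ (m + 1)) f x := by
    rw [hQY.add_pow]
    simp only [LinearMap.sum_apply, Finset.sum_apply]
    rw [Finset.sum_range_succ' _ (m + 1)]
    refine le_trans (Finset.sum_le_sum fun j _ => ?_) le_self_add
    rw [← nsmul_eq_mul', ht, Nat.add_sub_add_right]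
    simp
  have h3 : (Y * (ENNReal.ofReal (s ^ (-p)) • (ENNReal.ofReal s • Y + Q)) ^ m) f x
      = ∑ j ∈ Finset.range (m + 1),
        (ENNReal.ofReal (s ^ (-p)) ^ m * ENNReal.ofReal s ^ j * (m.choose j : ℝ≥0∞)) * t j := by
    rw [smul_pow, (hQY.smul_left (ENNReal.ofReal s)).add_pow, Finset.smul_sum, Finset.mul_sum]
    simp only [LinearMap.sum_apply, Finset.sum_apply]
    refine Finset.sum_congr rfl fun j _ => ?_
    rw [smul_pow, ← nsmul_eq_mul', smul_mul_assoc, mul_smul_comm, mul_smul_comm, mul_smul_comm,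
      ← mul_assoc, ← pow_succ', ht]
    simp
    ring
  rw [h1, h3]
  refine le_trans ?_ (add_le_add (mul_le_mul' le_rfl h2) le_rfl)
  rw [Finset.mul_sum, Finset.mul_sum, ← Finset.sum_add_distrib]
  refine Finset.sum_le_sum fun j _ => ?_
  rw [← mul_assoc, ← mul_assoc, ← add_mul]
  gcongr
  have := ENNReal.ofReal_le_ofReal (choose_le_add hp hs m j)
  rw [ENNReal.ofReal_add (by positivity) (by positivity), ENNReal.ofReal_mul hp.le,
    ENNReal.ofReal_mul (by positivity), ENNReal.ofReal_mul (by positivity),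
    ENNReal.ofReal_mul (by positivity), ENNReal.ofReal_pow (by positivity),
    ENNReal.ofReal_pow hs0.le] at this
  simp only [ENNReal.ofReal_natCast] at this
  simpa only [mul_assoc] using this

variable {V : Type*} [AddCommGroup V] {m : V → ℝ≥0∞} {A : Set V}

lemma tsum_kernE_mul_le {e : V → ℝ≥0∞} {c : ℝ≥0∞}
    (he : ∀ x, ∑' z, m (z - x) * e z ≤ c * e x) (n : ℕ) (x : V) :
    ∑' y, kernE m A n x y * e y ≤ c ^ n * e x := by
  induction n generalizing x with
  | zero =>
    rw [tsum_eq_single x]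
    · simp only [kernE]; split_ifs <;> simp
    · intro y hy; simp [kernE, hy.symm]
  | succ n ih =>
    by_cases hx : x ∈ A
    · simp_rw [kernE_succ_of_mem hx, ← ENNReal.tsum_mul_right]
      rw [ENNReal.tsum_comm]
      calc _ = ∑' z, m (z - x) * ∑' y, kernE m A n z y * e y := by
            simp_rw [mul_assoc, ENNReal.tsum_mul_left]
        _ ≤ ∑' z, m (z - x) * (c ^ n * e z) := by gcongr with z; exact ih z
        _ = c ^ n * ∑' z, m (z - x) * e z := by
            rw [← ENNReal.tsum_mul_left]; exact tsum_congr fun z => by ring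
        _ ≤ c ^ n * (c * e x) := by gcongr; exact he x
        _ = _ := by ring
    · simp [kernE_left_notMem hx]

lemma kernelOp_kernE_pow_apply (k n r : ℕ) (y x : V) :
    (kernelOp (kernE m A k) ^ n) (fun z => kernE m A r z y) x = kernE m A (k * n + r) x y := by
  induction n generalizing x with
  | zero => simp
  | succ n ih =>
    rw [pow_succ', Module.End.mul_apply, kernelOp_apply]
    simp_rw [ih]
    rw [← kernE_add]
    congr 1
    ring

lemma tsum_residues {k : ℕ} (hk : 0 < k) (f : ℕ → ℝ≥0∞) :
    ∑' n, f n = ∑' n, ∑ r ∈ Finset.range k, f (k * n + r) := by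
  have : NeZero k := ⟨hk.ne'⟩
  rw [← (Nat.divModEquiv k).symm.tsum_eq f, ENNReal.tsum_prod']
  refine tsum_congr fun n => ?_
  rw [tsum_fintype, Finset.sum_range]
  simp [mul_comm]

/-- Comparison of the Green function with its translate in a direction leaving `A` invariant,
up to an error that is controlled by an eigenfunction `e`. -/
lemma greenE_shift_le {w : V} (hw : ∀ x, x + w ∈ A ↔ x ∈ A) {k : ℕ} (hk : 0 < k) {ε : ℝ≥0∞}
    (hε : ∀ x ∈ A, ε ≤ kernE m A k x (x + w))
    {p s : ℝ} (hp : 0 < p) (hs : 1 < s) {e : V → ℝ≥0∞} {c ω r : ℝ≥0∞}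
    (he : ∀ x, ∑' z, m (z - x) * e z ≤ c * e x) (heω : ∀ x, e (x + w) = ω * e x)
    (hr : ENNReal.ofReal (s ^ (-p)) * (c ^ k + ENNReal.ofReal (s - 1) * (ε * ω)) ≤ r)
    {x y : V} (hx : x ∈ A) (hey : e y ≠ 0) (hey_top : e y ≠ ∞) :
    ε * greenE m A (x + w) y ≤ ENNReal.ofReal p * greenE m A x y +
      ENNReal.ofReal (s ^ (1 - p)) * ((1 - r)⁻¹ * (∑ i ∈ Finset.range k, c ^ i) *
        ε * ω * e x) * (e y)⁻¹ := by
  set Yk : V → V → ℝ≥0∞ := fun x y => if x ∈ A ∧ y = x + w then ε else 0 with hYk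
  have hYle : ∀ x y, Yk x y ≤ kernE m A k x y := by
    intro x y
    simp only [hYk]
    split_ifs with h
    · rw [h.2]; exact hε x h.1
    · exact zero_le
  set Qk : V → V → ℝ≥0∞ := fun x y => kernE m A k x y - Yk x y with hQk
  set Y := kernelOp Yk with hY
  set Q := kernelOp Qk with hQ
  have hYapp : ∀ f x, Y f x = if x ∈ A then ε * f (x + w) else 0 := by
    intro f x
    rw [hY, kernelOp_apply, tsum_eq_single (x + w)]
    · by_cases h : x ∈ A <;> simp [hYk, h]
    · intro z hz; simp [hYk, hz]
  have hS : kernelOp (kernE m A k) = Y + Q := by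
    ext f x
    simp only [hY, hQ, LinearMap.add_apply, Pi.add_apply, kernelOp_apply, ← ENNReal.tsum_add,
      ← add_mul, hQk]
    simp_rw [add_tsub_cancel_of_le (hYle _ _)]
  have hQleft : ∀ x, x ∉ A → ∀ y, Qk x y = 0 := by
    intro x hx y; simp [hQk, kernE_left_notMem hx]
  have hQright : ∀ y, y ∉ A → ∀ x, Qk x y = 0 := by
    intro y hy x; simp [hQk, kernE_right_notMem hy]
  have hQshift : ∀ x y, Qk (x + w) (y + w) = Qk x y := by
    intro x y; simp [hQk, hYk, kernE_shift hw, hw]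
  have hcomm : Commute Y Q := by
    ext f x
    simp only [Module.End.mul_apply]
    rw [hYapp, hQ, kernelOp_apply, kernelOp_apply]
    simp_rw [hYapp]
    by_cases h : x ∈ A
    · rw [if_pos h, ← (Equiv.addRight w).tsum_eq, ← ENNReal.tsum_mul_left]
      refine tsum_congr fun z => ?_
      simp only [Equiv.coe_addRight, hQshift]
      by_cases hz : z ∈ A
      · rw [if_pos hz]; ring
      · simp [hQright z hz]
    · simp [h, hQleft x h]
  set B := ENNReal.ofReal (s ^ (-p)) • (ENNReal.ofReal s • Y + Q) with hB
  have hBe : B e ≤ r • e := by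
    intro x
    have hsum : ENNReal.ofReal s • Y + Q
        = kernelOp (kernE m A k) + ENNReal.ofReal (s - 1) • Y := by
      have : ENNReal.ofReal s = 1 + ENNReal.ofReal (s - 1) := by
        rw [← ENNReal.ofReal_one, ← ENNReal.ofReal_add (by norm_num) (by linarith)]
        congr 1; ring
      rw [this, hS, add_smul, one_smul]
      abel
    rw [hB, hsum]
    simp only [LinearMap.smul_apply, LinearMap.add_apply, Pi.smul_apply, Pi.add_apply,
      smul_eq_mul]
    have h1 : kernelOp (kernE m A k) e x ≤ c ^ k * e x := tsum_kernE_mul_le he k x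
    have h2 : Y e x ≤ ε * (ω * e x) := by
      rw [hYapp, ← heω]
      split_ifs
      · exact le_rfl
      · exact zero_le
    calc _ ≤ ENNReal.ofReal (s ^ (-p)) *
          (c ^ k * e x + ENNReal.ofReal (s - 1) * (ε * (ω * e x))) := by gcongr
      _ = ENNReal.ofReal (s ^ (-p)) * (c ^ k + ENNReal.ofReal (s - 1) * (ε * ω)) * e x := by ring
      _ ≤ r * e x := by gcongr
  set ψ : V → ℝ≥0∞ := fun z => ∑ i ∈ Finset.range k, kernE m A i z y with hψ
  have hψe : ψ ≤ ((∑ i ∈ Finset.range k, c ^ i) * (e y)⁻¹) • e := by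
    intro z
    simp only [hψ, Pi.smul_apply, smul_eq_mul, Finset.sum_mul]
    refine Finset.sum_le_sum fun i _ => ?_
    have : kernE m A i z y * e y ≤ c ^ i * e z :=
      (ENNReal.le_tsum (f := fun y => kernE m A i z y * e y) y).trans (tsum_kernE_mul_le he i z)
    calc kernE m A i z y = kernE m A i z y * e y * (e y)⁻¹ := by
          rw [mul_assoc, ENNReal.mul_inv_cancel hey hey_top, mul_one]
      _ ≤ c ^ i * e z * (e y)⁻¹ := by gcongr
      _ = _ := by ring
  have hSψ : ∀ n z, ((Y + Q) ^ n) ψ z = ∑ i ∈ Finset.range k, kernE m A (k * n + i) z y := by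
    intro n z
    have : ψ = ∑ i ∈ Finset.range k, fun z => kernE m A i z y := by
      ext z; simp [hψ]
    rw [← hS, this, map_sum, Finset.sum_apply]
    simp_rw [kernelOp_kernE_pow_apply]
  have hgreen : ∀ z, greenE m A z y = ∑' n, ((Y + Q) ^ n) ψ z := by
    intro z
    simp_rw [hSψ]
    exact tsum_residues hk _
  have hmain := fun n => end_mul_pow_le hcomm hp hs n ψ x
  have herr : ∀ n, (Y * B ^ n) ψ x ≤
      ε * (r ^ n * ((∑ i ∈ Finset.range k, c ^ i) * (e y)⁻¹) * (ω * e x)) := by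
    intro n
    rw [Module.End.mul_apply, hYapp, if_pos hx, ← heω]
    gcongr
    exact pow_apply_le B hBe hψe n (x + w)
  calc ε * greenE m A (x + w) y = ∑' n, (Y * (Y + Q) ^ n) ψ x := by
        rw [hgreen, ← ENNReal.tsum_mul_left]
        refine tsum_congr fun n => ?_
        rw [Module.End.mul_apply, hYapp, if_pos hx]
    _ ≤ ∑' n, (ENNReal.ofReal p * ((Y + Q) ^ (n + 1)) ψ x
          + ENNReal.ofReal (s ^ (1 - p)) *
          (ε * (r ^ n * ((∑ i ∈ Finset.range k, c ^ i) * (e y)⁻¹) * (ω * e x)))) := by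
        refine ENNReal.tsum_le_tsum fun n => (hmain n).trans ?_
        gcongr
        exact herr n
    _ ≤ _ := by
        rw [ENNReal.tsum_add, ENNReal.tsum_mul_left, ENNReal.tsum_mul_left, ENNReal.tsum_mul_left,
          ENNReal.tsum_mul_right, ENNReal.tsum_mul_right, ENNReal.tsum_geometric]
        refine add_le_add ?_ (le_of_eq (by ring))
        gcongr
        rw [hgreen]
        exact ENNReal.tsum_comp_le_tsum_of_injective (add_left_injective 1) _

end Ratio

section Laplace

variable {d : ℕ} {μ : (Fin d → ℤ) → ℝ}

lemma dotZ_add_left (a b : Fin d → ℝ) (z : Fin d → ℤ) :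
    dotZ (a + b) z = dotZ a z + dotZ b z := by
  simp [dotZ, add_mul, Finset.sum_add_distrib]

lemma dotZ_add_right (a : Fin d → ℝ) (y z : Fin d → ℤ) :
    dotZ a (y + z) = dotZ a y + dotZ a z := by
  simp [dotZ, mul_add, Finset.sum_add_distrib]

lemma dotZ_sub_right (a : Fin d → ℝ) (y z : Fin d → ℤ) :
    dotZ a (y - z) = dotZ a y - dotZ a z := by
  simp [dotZ, mul_sub, Finset.sum_sub_distrib]

lemma dotZ_smul_left (c : ℝ) (a : Fin d → ℝ) (z : Fin d → ℤ) :
    dotZ (c • a) z = c * dotZ a z := by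
  simp [dotZ, mul_assoc, Finset.mul_sum]

lemma dotZ_single (i : Fin d) (c : ℝ) (z : Fin d → ℤ) :
    dotZ (Pi.single i c) z = c * z i := by
  rw [dotZ, Finset.sum_eq_single i]
  · simp
  · intro j _ hj; simp [hj]
  · simp

lemma znorm_nonneg {ι : Type*} [Fintype ι] (z : ι → ℤ) : 0 ≤ znorm z :=
  Finset.sum_nonneg fun _ _ => abs_nonneg _

lemma rnorm_nonneg {ι : Type*} [Fintype ι] (q : ι → ℝ) : 0 ≤ rnorm q :=
  Finset.sum_nonneg fun _ _ => abs_nonneg _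

lemma abs_le_znorm {ι : Type*} [Fintype ι] (z : ι → ℤ) (i : ι) : |(z i : ℝ)| ≤ znorm z :=
  Finset.single_le_sum (f := fun i => |(z i : ℝ)|) (fun _ _ => abs_nonneg _) (Finset.mem_univ i)

lemma abs_le_rnorm {ι : Type*} [Fintype ι] (q : ι → ℝ) (i : ι) : |q i| ≤ rnorm q :=
  Finset.single_le_sum (f := fun i => |q i|) (fun _ _ => abs_nonneg _) (Finset.mem_univ i)

lemma abs_dotZ_le (a : Fin d → ℝ) (z : Fin d → ℤ) : |dotZ a z| ≤ rnorm a * znorm z := by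
  unfold dotZ
  refine (Finset.abs_sum_le_sum_abs _ _).trans ?_
  rw [rnorm, Finset.sum_mul]
  refine Finset.sum_le_sum fun i _ => ?_
  rw [abs_mul]
  exact mul_le_mul_of_nonneg_left (abs_le_znorm z i) (abs_nonneg _)

lemma dotZ_zero (z : Fin d → ℤ) : dotZ 0 z = 0 := by simp [dotZ]

/-- The exponential function `x ↦ exp (a · x)` with values in `ℝ≥0∞`. -/
def expE (a : Fin d → ℝ) (x : Fin d → ℤ) : ℝ≥0∞ := ENNReal.ofReal (Real.exp (dotZ a x))

lemma expE_ne_zero (a : Fin d → ℝ) (x : Fin d → ℤ) : expE a x ≠ 0 := by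
  simp [expE, Real.exp_pos]

lemma expE_ne_top (a : Fin d → ℝ) (x : Fin d → ℤ) : expE a x ≠ ∞ := by simp [expE]

lemma expE_add (a : Fin d → ℝ) (x y : Fin d → ℤ) : expE a (x + y) = expE a x * expE a y := by
  rw [expE, expE, expE, dotZ_add_right, Real.exp_add, ENNReal.ofReal_mul (Real.exp_pos _).le]

lemma tsum_step_mul_expE (hnn : ∀ z, 0 ≤ μ z) (a : Fin d → ℝ) (x : Fin d → ℤ) :
    ∑' z, ENNReal.ofReal (μ (z - x)) * expE a z = phiE μ a * expE a x := by
  rw [← (Equiv.addRight x).tsum_eq, phiE, ← ENNReal.tsum_mul_right]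
  refine tsum_congr fun z => ?_
  simp only [Equiv.coe_addRight, add_sub_cancel_right, expE_add]
  rw [ENNReal.ofReal_mul (hnn z), mul_assoc]
  rfl

lemma phiE_zero (hnn : ∀ z, 0 ≤ μ z) (hsum : HasSum μ 1) : phiE μ 0 = 1 := by
  simp only [phiE, dotZ_zero, Real.exp_zero, mul_one]
  rw [← ENNReal.ofReal_tsum_of_nonneg hnn hsum.summable, hsum.tsum_eq, ENNReal.ofReal_one]

lemma isClosed_Dset : IsClosed (Dset μ) := by
  have : Dset μ = ⋂ s : Finset (Fin d → ℤ),
      {a | ∑ z ∈ s, ENNReal.ofReal (μ z * Real.exp (dotZ a z)) ≤ 1} := by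
    ext a
    simp only [Dset, phiE, Set.mem_ofPred_eq, Set.mem_iInter, ENNReal.tsum_eq_iSup_sum, iSup_le_iff]
  rw [this]
  refine isClosed_iInter fun s => isClosed_le ?_ continuous_const
  refine continuous_finsetSum _ fun z _ => ENNReal.continuous_ofReal.comp ?_
  unfold dotZ
  fun_prop

lemma exists_dotZ_le (h : Irred μ (posDom (∅ : Set (Fin d)))) (v : Fin d → ℤ) :
    ∃ C, ∀ a ∈ Dset μ, dotZ a v ≤ C := by
  obtain ⟨k, c, h0, hk, -, hpos⟩ := h 0 (by simp [posDom]) v (by simp [posDom])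
  refine ⟨∑ j ∈ Finset.range k, -Real.log (μ (c (j + 1) - c j)), fun a ha => ?_⟩
  have hv : dotZ a v = ∑ j ∈ Finset.range k, dotZ a (c (j + 1) - c j) := by
    simp_rw [dotZ_sub_right]
    rw [Finset.sum_range_sub (fun j => dotZ a (c j)), h0, hk]
    simp [dotZ]
  rw [hv]
  refine Finset.sum_le_sum fun j hj => ?_
  have hp := hpos j (Finset.mem_range.1 hj)
  have h1 : ENNReal.ofReal (μ (c (j + 1) - c j) * Real.exp (dotZ a (c (j + 1) - c j))) ≤ 1 :=
    (ENNReal.le_tsum (f := fun z => ENNReal.ofReal (μ z * Real.exp (dotZ a z))) _).trans ha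
  rw [ENNReal.ofReal_le_one] at h1
  have h2 := Real.log_le_log (by positivity) h1
  rw [Real.log_mul hp.ne' (Real.exp_pos _).ne', Real.log_exp, Real.log_one] at h2
  linarith

lemma isCompact_Dset (h : Irred μ (posDom (∅ : Set (Fin d)))) : IsCompact (Dset μ) := by
  choose C₁ hC₁ using fun i : Fin d => exists_dotZ_le h (Pi.single i 1)
  choose C₂ hC₂ using fun i : Fin d => exists_dotZ_le h (Pi.single i (-1))
  have hs : ∀ (a : Fin d → ℝ) (i : Fin d) (c : ℤ), dotZ a (Pi.single i c) = a i * c := by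
    intro a i c
    rw [dotZ, Finset.sum_eq_single i]
    · simp
    · intro j _ hj; simp [hj]
    · simp
  refine (isCompact_Icc (a := fun i => -C₂ i) (b := C₁)).of_isClosed_subset isClosed_Dset ?_
  intro a ha
  refine ⟨fun i => ?_, fun i => ?_⟩
  · have := hC₂ i a ha
    rw [hs] at this
    push_cast at this
    linarith
  · have := hC₁ i a ha
    rw [hs] at this
    push_cast at this
    linarith

lemma exp_mul_znorm_le {r : ℝ} (hr : 0 ≤ r) (z : Fin d → ℤ) :
    Real.exp (r * znorm z) ≤
      1 + ∑ i, (Real.exp (r * d * z i) + Real.exp (-(r * d) * z i)) := by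
  rcases Nat.eq_zero_or_pos d with rfl | hd
  · simp [znorm]
  · have : Nonempty (Fin d) := ⟨⟨0, hd⟩⟩
    obtain ⟨i, -, hi⟩ := Finset.exists_max_image Finset.univ (fun i => |(z i : ℝ)|)
      Finset.univ_nonempty
    have h1 : znorm z ≤ d * |(z i : ℝ)| := by
      refine (Finset.sum_le_card_nsmul _ _ _ fun j hj => hi j hj).trans ?_
      simp
    have h2 : Real.exp (r * znorm z) ≤ Real.exp (r * d * z i) + Real.exp (-(r * d) * z i) := by
      have : r * znorm z ≤ r * d * |(z i : ℝ)| := by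
        rw [mul_assoc]; gcongr
      rcases abs_cases (z i : ℝ) with ⟨h, -⟩ | ⟨h, -⟩ <;> rw [h] at this
      · have := Real.exp_le_exp.2 this
        have := Real.exp_pos (-(r * d) * z i)
        linarith
      · have := Real.exp_le_exp.2 this
        have := Real.exp_pos (r * d * z i)
        rw [neg_mul, ← mul_neg]
        linarith
    have h3 := Finset.single_le_sum
      (f := fun i => Real.exp (r * d * z i) + Real.exp (-(r * d) * z i))
      (fun i _ => by positivity) (Finset.mem_univ i)
    linarith

/-- Exponential moments, uniformly on `Dset μ`. -/
lemma exists_expMoment (hnn : ∀ z, 0 ≤ μ z) (h : Irred μ (posDom (∅ : Set (Fin d))))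
    (hA2 : A2 μ) : ∃ r > 0, ∀ b ∈ Dset μ,
      Summable fun z => μ z * Real.exp (dotZ b z + r * znorm z) := by
  obtain ⟨U, hUo, hDU, hU⟩ := hA2
  obtain ⟨δ, hδ, hδU⟩ := (isCompact_Dset h).exists_cthickening_subset_open hUo hDU
  have hd1 : (0 : ℝ) < d + 1 := by positivity
  refine ⟨δ / (d + 1), by positivity, fun b hb => ?_⟩
  set r := δ / (d + 1) with hr
  have hr0 : 0 < r := by positivity
  have hrd : r * d ≤ δ := by
    have : r * (d + 1) = δ := by rw [hr]; field_simp
    nlinarith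
  have hsm : ∀ a ∈ U, Summable fun z => μ z * Real.exp (dotZ a z) := by
    intro a ha
    refine (ENNReal.summable_toReal (hU a ha)).congr fun z => ?_
    rw [ENNReal.toReal_ofReal (mul_nonneg (hnn z) (Real.exp_pos _).le)]
  have hmem : ∀ (i : Fin d) (c : ℝ), |c| ≤ δ → b + Pi.single i c ∈ U := by
    intro i c hc
    refine hδU (Metric.mem_cthickening_of_dist_le _ b _ _ hb ?_)
    rw [dist_eq_norm, add_sub_cancel_left, Pi.norm_single]
    exact hc
  have hbig : Summable fun z => μ z * Real.exp (dotZ b z) +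
      ∑ i : Fin d, (μ z * Real.exp (dotZ (b + Pi.single i (r * d)) z)
        + μ z * Real.exp (dotZ (b + Pi.single i (-(r * d))) z)) := by
    refine (hsm b (hDU hb)).add (summable_sum fun i _ => (hsm _ (hmem i _ ?_)).add
      (hsm _ (hmem i _ ?_)))
    · rwa [abs_of_nonneg (by positivity)]
    · rwa [abs_neg, abs_of_nonneg (by positivity)]
  refine hbig.of_nonneg_of_le (fun z => mul_nonneg (hnn z) (Real.exp_pos _).le) fun z => ?_
  have h1 := mul_le_mul_of_nonneg_left (exp_mul_znorm_le hr0.le z)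
    (mul_nonneg (hnn z) (Real.exp_pos (dotZ b z)).le)
  rw [Real.exp_add, ← mul_assoc]
  refine h1.trans (le_of_eq ?_)
  simp_rw [dotZ_add_left, dotZ_single, Real.exp_add]
  rw [mul_add, mul_one, Finset.mul_sum]
  congr 1
  refine Finset.sum_congr rfl fun i _ => ?_
  ring

lemma exp_le_quadratic (x : ℝ) : Real.exp x ≤ 1 + x + x ^ 2 * Real.exp |x| := by
  have he : 1 ≤ Real.exp |x| := Real.one_le_exp (abs_nonneg x)
  rcases le_or_gt |x| 1 with h | h
  · have h1 := (abs_le.1 (Real.norm_exp_sub_one_sub_id_le (x := x) h)).2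
    rw [Real.norm_eq_abs, sq_abs] at h1
    nlinarith [sq_nonneg x]
  · rcases abs_cases x with ⟨h1, h2⟩ | ⟨h1, h2⟩
    · rw [h1] at h he ⊢
      have : 1 ≤ x ^ 2 := by nlinarith
      nlinarith [Real.exp_pos x]
    · have : Real.exp x ≤ 1 := Real.exp_le_one_iff.2 h2.le
      nlinarith [sq_nonneg x]

/-- Gradient of the jump generating function. -/
def gradPhi (μ : (Fin d → ℤ) → ℝ) (b : Fin d → ℝ) : Fin d → ℝ :=
  fun i => ∑' z, μ z * Real.exp (dotZ b z) * z i

variable {b : Fin d → ℝ} {r : ℝ}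

lemma summable_exp_of_expMoment (hnn : ∀ z, 0 ≤ μ z) (hr : 0 < r)
    (hb : Summable fun z => μ z * Real.exp (dotZ b z + r * znorm z)) :
    Summable fun z => μ z * Real.exp (dotZ b z) := by
  refine hb.of_nonneg_of_le (fun z => mul_nonneg (hnn z) (Real.exp_pos _).le) fun z => ?_
  refine mul_le_mul_of_nonneg_left (Real.exp_le_exp.2 ?_) (hnn z)
  have := mul_nonneg hr.le (znorm_nonneg z)
  linarith

lemma summable_mul_of_expMoment (hnn : ∀ z, 0 ≤ μ z) (hr : 0 < r)
    (hb : Summable fun z => μ z * Real.exp (dotZ b z + r * znorm z)) (i : Fin d) :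
    Summable fun z => μ z * Real.exp (dotZ b z) * z i := by
  refine Summable.of_norm_bounded (hb.mul_left r⁻¹) fun z => ?_
  have hpos : 0 ≤ μ z * Real.exp (dotZ b z) := mul_nonneg (hnn z) (Real.exp_pos _).le
  rw [norm_mul, Real.norm_of_nonneg hpos, Real.norm_eq_abs, Real.exp_add]
  have h1 : |(z i : ℝ)| ≤ r⁻¹ * Real.exp (r * znorm z) := by
    rw [inv_mul_eq_div, le_div_iff₀ hr]
    have := Real.add_one_le_exp (r * znorm z)
    have := abs_le_znorm z i
    nlinarith
  calc _ ≤ μ z * Real.exp (dotZ b z) * (r⁻¹ * Real.exp (r * znorm z)) := by gcongr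
    _ = _ := by ring

lemma phiE_eq_ofReal (hnn : ∀ z, 0 ≤ μ z)
    (hb : Summable fun z => μ z * Real.exp (dotZ b z)) :
    phiE μ b = ENNReal.ofReal (∑' z, μ z * Real.exp (dotZ b z)) := by
  rw [ENNReal.ofReal_tsum_of_nonneg (fun z => mul_nonneg (hnn z) (Real.exp_pos _).le) hb]
  rfl

lemma hasSum_dotZ (hnn : ∀ z, 0 ≤ μ z) (hr : 0 < r)
    (hb : Summable fun z => μ z * Real.exp (dotZ b z + r * znorm z)) (θ : Fin d → ℝ) :
    HasSum (fun z => μ z * Real.exp (dotZ b z) * dotZ θ z) (dotR θ (gradPhi μ b)) := by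
  have := hasSum_sum (s := Finset.univ) (fun (i : Fin d) _ =>
    ((summable_mul_of_expMoment hnn hr hb i).hasSum).mul_left (θ i))
  have heq : (fun z => μ z * Real.exp (dotZ b z) * dotZ θ z)
      = fun z => ∑ i, θ i * (μ z * Real.exp (dotZ b z) * z i) := by
    funext z
    rw [show dotZ θ z = ∑ i, θ i * (z i : ℝ) from rfl, Finset.mul_sum]
    exact Finset.sum_congr rfl fun i _ => by ring
  rw [heq]
  exact this

lemma exists_phiE_le (hnn : ∀ z, 0 ≤ μ z) (hr : 0 < r)
    (hb : Summable fun z => μ z * Real.exp (dotZ b z + r * znorm z)) :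
    ∃ C > 0, ∀ θ : Fin d → ℝ, rnorm θ ≤ r / 2 → phiE μ (b + θ) ≤
      ENNReal.ofReal ((phiE μ b).toReal + dotR θ (gradPhi μ b) + C * rnorm θ ^ 2) := by
  set S := ∑' z, μ z * Real.exp (dotZ b z + r * znorm z) with hS
  have hS0 : 0 ≤ S := tsum_nonneg fun z => mul_nonneg (hnn z) (Real.exp_pos _).le
  have hsm := summable_exp_of_expMoment hnn hr hb
  refine ⟨8 / r ^ 2 * S + 1, by positivity, fun θ hθ => ?_⟩
  set R : (Fin d → ℤ) → ℝ := fun z => μ z * Real.exp (dotZ b z)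
    + μ z * Real.exp (dotZ b z) * dotZ θ z
    + rnorm θ ^ 2 * (8 / r ^ 2) * (μ z * Real.exp (dotZ b z + r * znorm z)) with hR
  have hRsum : HasSum R ((phiE μ b).toReal + dotR θ (gradPhi μ b)
      + rnorm θ ^ 2 * (8 / r ^ 2) * S) := by
    refine HasSum.add (HasSum.add ?_ (hasSum_dotZ hnn hr hb θ)) (hb.hasSum.mul_left _)
    rw [phiE_eq_ofReal hnn hsm, ENNReal.toReal_ofReal
      (tsum_nonneg fun z => mul_nonneg (hnn z) (Real.exp_pos _).le)]
    exact hsm.hasSum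
  have hle : ∀ z, μ z * Real.exp (dotZ (b + θ) z) ≤ R z := by
    intro z
    have hpos : 0 ≤ μ z * Real.exp (dotZ b z) := mul_nonneg (hnn z) (Real.exp_pos _).le
    have hx := abs_dotZ_le θ z
    have hn := znorm_nonneg z
    have h1 : dotZ θ z ^ 2 * Real.exp |dotZ θ z|
        ≤ rnorm θ ^ 2 * (8 / r ^ 2) * Real.exp (r * znorm z) := by
      have h2 : dotZ θ z ^ 2 ≤ rnorm θ ^ 2 * znorm z ^ 2 := by
        rw [← sq_abs, ← mul_pow]
        gcongr
      have h3 : Real.exp |dotZ θ z| ≤ Real.exp (r / 2 * znorm z) :=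
        Real.exp_le_exp.2 (hx.trans (by gcongr))
      have h4 : znorm z ^ 2 ≤ 8 / r ^ 2 * Real.exp (r / 2 * znorm z) := by
        have := Real.quadratic_le_exp_of_nonneg (x := r / 2 * znorm z) (by positivity)
        have h5 : (r / 2 * znorm z) ^ 2 / 2 ≤ Real.exp (r / 2 * znorm z) := by
          have : 0 ≤ r / 2 * znorm z := by positivity
          linarith
        rw [div_mul_eq_mul_div, le_div_iff₀ (by positivity)]
        nlinarith
      calc _ ≤ (rnorm θ ^ 2 * (8 / r ^ 2 * Real.exp (r / 2 * znorm z)))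
            * Real.exp (r / 2 * znorm z) := by
            refine mul_le_mul (h2.trans (by gcongr)) h3 (Real.exp_pos _).le (by positivity)
        _ = rnorm θ ^ 2 * (8 / r ^ 2)
            * (Real.exp (r / 2 * znorm z) * Real.exp (r / 2 * znorm z)) := by ring
        _ = _ := by rw [← Real.exp_add]; ring_nf
    have h6 := mul_le_mul_of_nonneg_left ((exp_le_quadratic (dotZ θ z)).trans
      (add_le_add_right h1 _)) hpos
    rw [dotZ_add_left, Real.exp_add, ← mul_assoc]
    refine h6.trans (le_of_eq ?_)
    simp only [hR, Real.exp_add]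
    ring
  have hR0 : ∀ z, 0 ≤ R z := fun z => (mul_nonneg (hnn z) (Real.exp_pos _).le).trans (hle z)
  calc phiE μ (b + θ) ≤ ∑' z, ENNReal.ofReal (R z) :=
        ENNReal.tsum_le_tsum fun z => ENNReal.ofReal_le_ofReal (hle z)
    _ = ENNReal.ofReal (∑' z, R z) := (ENNReal.ofReal_tsum_of_nonneg hR0 hRsum.summable).symm
    _ ≤ _ := by
        rw [hRsum.tsum_eq]
        refine ENNReal.ofReal_le_ofReal ?_
        nlinarith [sq_nonneg (rnorm θ)]

lemma le_phiE (hnn : ∀ z, 0 ≤ μ z) (hr : 0 < r)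
    (hb : Summable fun z => μ z * Real.exp (dotZ b z + r * znorm z)) (θ : Fin d → ℝ) :
    ENNReal.ofReal ((phiE μ b).toReal + dotR θ (gradPhi μ b)) ≤ phiE μ (b + θ) := by
  by_cases htop : phiE μ (b + θ) = ∞
  · simp [htop]
  have hsm := summable_exp_of_expMoment hnn hr hb
  have hθ : Summable fun z => μ z * Real.exp (dotZ (b + θ) z) := by
    refine (ENNReal.summable_toReal htop).congr fun z => ?_
    rw [ENNReal.toReal_ofReal (mul_nonneg (hnn z) (Real.exp_pos _).le)]
  rw [phiE_eq_ofReal hnn hθ, phiE_eq_ofReal hnn hsm, ENNReal.toReal_ofReal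
      (tsum_nonneg fun z => mul_nonneg (hnn z) (Real.exp_pos _).le)]
  refine ENNReal.ofReal_le_ofReal ?_
  refine hasSum_le (fun z => ?_) (hsm.hasSum.add (hasSum_dotZ hnn hr hb θ)) hθ.hasSum
  have hpos : 0 ≤ μ z * Real.exp (dotZ b z) := mul_nonneg (hnn z) (Real.exp_pos _).le
  rw [dotZ_add_left, Real.exp_add, ← mul_assoc]
  have := mul_le_mul_of_nonneg_left (Real.add_one_le_exp (dotZ θ z)) hpos
  linarith

lemma gradPhi_zero : gradPhi μ 0 = Mvec μ := by
  ext i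
  simp [gradPhi, Mvec, dotZ_zero]

end Laplace

section Reach

variable {d : ℕ} {μ : (Fin d → ℤ) → ℝ} {Λ : Set (Fin d)}

/-- The step distribution, with values in `ℝ≥0∞`. -/
abbrev muE {V : Type*} (μ : V → ℝ) : V → ℝ≥0∞ := fun z => ENNReal.ofReal (μ z)

lemma one_mem_posDom : (1 : Fin d → ℤ) ∈ posDom Λ := fun i _ => by simp

lemma add_mem_posDom {v : Fin d → ℤ} (hv : ∀ i ∈ Λ, 0 ≤ v i) :
    ∀ x ∈ posDom Λ, x + v ∈ posDom Λ := fun _ hx i hi =>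
  add_pos_of_pos_of_nonneg (hx i hi) (hv i hi)

lemma sub_one_nonneg_of_mem {x : Fin d → ℤ} (hx : x ∈ posDom Λ) : ∀ i ∈ Λ, 0 ≤ (x - 1) i :=
  fun i hi => by have := hx i hi; simp only [Pi.sub_apply, Pi.one_apply]; lia

lemma reachE_le_shift_posDom {v : Fin d → ℤ} (hv : ∀ i ∈ Λ, 0 ≤ v i) (x y : Fin d → ℤ) :
    reachE (muE μ) (posDom Λ) x y ≤ reachE (muE μ) (posDom Λ) (x + v) (y + v) :=
  reachE_le_shift (add_mem_posDom hv) x y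

lemma kernE_pos_of_irred {V : Type*} [AddCommGroup V] {μ : V → ℝ} {A : Set V} (h : Irred μ A)
    {x y : V} (hx : x ∈ A) (hy : y ∈ A) : ∃ n, 0 < kernE (muE μ) A n x y := by
  obtain ⟨k, c, rfl, rfl, hc, hpos⟩ := h x hx y hy
  exact ⟨k, kernE_pos_of_chain k c hc fun j hj => ENNReal.ofReal_pos.2 (hpos j hj)⟩

lemma reachE_pos {V : Type*} [AddCommGroup V] {μ : V → ℝ} {A : Set V} (h : Irred μ A)
    {x y : V} (hx : x ∈ A) (hy : y ∈ A) : 0 < reachE (muE μ) A x y := by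
  obtain ⟨n, hn⟩ := kernE_pos_of_irred h hx hy
  exact hn.trans_le (kernE_le_reachE n x y)

lemma exists_exp_neg_le {ι : Type*} [Finite ι] {f : ι → ℝ≥0∞} (hf : ∀ i, 0 < f i) :
    ∃ Γ : ℝ, 0 ≤ Γ ∧ ∀ i, ENNReal.ofReal (Real.exp (-Γ)) ≤ f i := by
  have : Fintype ι := Fintype.ofFinite ι
  have h1 : ∀ i, ∃ Γ : ℝ, 0 ≤ Γ ∧ ENNReal.ofReal (Real.exp (-Γ)) ≤ f i := by
    intro i
    have ht : Tendsto (fun Γ : ℝ => ENNReal.ofReal (Real.exp (-Γ))) atTop (𝓝 0) := by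
      simpa using ENNReal.tendsto_ofReal (Real.tendsto_exp_neg_atTop_nhds_zero)
    obtain ⟨Γ, h⟩ := ((ht.eventually (gt_mem_nhds (hf i))).and (eventually_ge_atTop 0)).exists
    exact ⟨Γ, h.2, h.1.le⟩
  choose Γ hΓ0 hΓ using h1
  refine ⟨∑ i, Γ i, Finset.sum_nonneg fun i _ => hΓ0 i, fun i => le_trans ?_ (hΓ i)⟩
  refine ENNReal.ofReal_le_ofReal (Real.exp_le_exp.2 (neg_le_neg ?_))
  exact Finset.single_le_sum (f := Γ) (fun i _ => hΓ0 i) (Finset.mem_univ i)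

lemma exists_unit_step_le_reachE (h : Irred μ (posDom Λ)) : ∃ Γ : ℝ, 0 ≤ Γ ∧
    ∀ (x : Fin d → ℤ) (i : Fin d), x ∈ posDom Λ → x + Pi.single i 1 ∈ posDom Λ ∧
      ENNReal.ofReal (Real.exp (-Γ)) ≤ reachE (muE μ) (posDom Λ) x (x + Pi.single i 1) ∧
      ENNReal.ofReal (Real.exp (-Γ)) ≤ reachE (muE μ) (posDom Λ) (x + Pi.single i 1) x := by
  have hs : ∀ (i : Fin d) (x : Fin d → ℤ), x ∈ posDom Λ → x + Pi.single i 1 ∈ posDom Λ :=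
    fun i x hx => add_mem_posDom (fun j _ => by
      rcases eq_or_ne j i with rfl | hj
      · simp
      · simp [hj]) x hx
  obtain ⟨Γ₁, h1, hΓ₁⟩ := exists_exp_neg_le (f := fun i : Fin d =>
    reachE (muE μ) (posDom Λ) 1 (1 + Pi.single i 1))
    fun i => reachE_pos h one_mem_posDom (hs i _ one_mem_posDom)
  obtain ⟨Γ₂, h2, hΓ₂⟩ := exists_exp_neg_le (f := fun i : Fin d =>
    reachE (muE μ) (posDom Λ) (1 + Pi.single i 1) 1)
    fun i => reachE_pos h (hs i _ one_mem_posDom) one_mem_posDom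
  refine ⟨Γ₁ + Γ₂, add_nonneg h1 h2, fun x i hx => ⟨hs i x hx, ?_, ?_⟩⟩
  · refine (ENNReal.ofReal_le_ofReal (Real.exp_le_exp.2 (by linarith))).trans
      ((hΓ₁ i).trans ?_)
    have := reachE_le_shift_posDom (μ := μ) (sub_one_nonneg_of_mem hx) 1 (1 + Pi.single i 1)
    rwa [show (1 : Fin d → ℤ) + (x - 1) = x by abel,
      show (1 : Fin d → ℤ) + Pi.single i 1 + (x - 1) = x + Pi.single i 1 by abel] at this
  · refine (ENNReal.ofReal_le_ofReal (Real.exp_le_exp.2 (by linarith))).trans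
      ((hΓ₂ i).trans ?_)
    have := reachE_le_shift_posDom (μ := μ) (sub_one_nonneg_of_mem hx) (1 + Pi.single i 1) 1
    rwa [show (1 : Fin d → ℤ) + (x - 1) = x by abel,
      show (1 : Fin d → ℤ) + Pi.single i 1 + (x - 1) = x + Pi.single i 1 by abel] at this

lemma znorm_eq_natCast {ι : Type*} [Fintype ι] (z : ι → ℤ) :
    znorm z = ((∑ i, (z i).natAbs : ℕ) : ℝ) := by
  simp [znorm, Nat.cast_natAbs]

lemma exists_exp_le_reachE (h : Irred μ (posDom Λ)) : ∃ Γ : ℝ, 0 ≤ Γ ∧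
    ∀ x ∈ posDom Λ, ∀ y ∈ posDom Λ,
      ENNReal.ofReal (Real.exp (-(Γ * znorm (y - x)))) ≤ reachE (muE μ) (posDom Λ) x y := by
  obtain ⟨Γ, hΓ, hstep⟩ := exists_unit_step_le_reachE h
  refine ⟨Γ, hΓ, ?_⟩
  have key : ∀ (n : ℕ) (x y : Fin d → ℤ), x ∈ posDom Λ → y ∈ posDom Λ →
      ∑ i, ((y - x) i).natAbs = n →
      ENNReal.ofReal (Real.exp (-(Γ * n))) ≤ reachE (muE μ) (posDom Λ) x y := by
    intro n
    induction n with
    | zero =>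
      intro x y hx hy hn
      obtain rfl : x = y := by
        ext i
        have := (Finset.sum_eq_zero_iff.1 hn) i (Finset.mem_univ i)
        simp only [Pi.sub_apply] at this
        lia
      simpa using reachE_self hx
    | succ n ih =>
      intro x y hx hy hn
      obtain ⟨i, hi⟩ : ∃ i, ((y - x) i).natAbs ≠ 0 := by
        by_contra! hc
        rw [Finset.sum_eq_zero fun i _ => hc i] at hn
        lia
      obtain ⟨x', hx', hstep', hn'⟩ : ∃ x' ∈ posDom Λ,
          ENNReal.ofReal (Real.exp (-Γ)) ≤ reachE (muE μ) (posDom Λ) x x' ∧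
          ∑ j, ((y - x') j).natAbs = n := by
        rw [← Finset.add_sum_erase _ _ (Finset.mem_univ i)] at hn
        have haux : ∀ x' : Fin d → ℤ, (∀ j ≠ i, x' j = x j) →
            ((y - x) i).natAbs = ((y - x') i).natAbs + 1 → ∑ j, ((y - x') j).natAbs = n := by
          intro x' hj hxi
          rw [← Finset.add_sum_erase _ _ (Finset.mem_univ i)]
          have : ∑ j ∈ Finset.univ.erase i, ((y - x') j).natAbs
              = ∑ j ∈ Finset.univ.erase i, ((y - x) j).natAbs :=
            Finset.sum_congr rfl fun j hj' => by simp [hj j (Finset.ne_of_mem_erase hj')]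
          lia
        rcases lt_or_ge (x i) (y i) with hlt | hge
        · refine ⟨x + Pi.single i 1, (hstep x i hx).1, (hstep x i hx).2.1, haux _ ?_ ?_⟩
          · intro j hj
            simp [hj]
          · simp only [Pi.sub_apply, Pi.add_apply, Pi.single_eq_same]
            lia
        · have hi' : y i < x i := by
            simp only [Pi.sub_apply, ne_eq] at hi
            lia
          have hmem : x - Pi.single i 1 ∈ posDom Λ := by
            intro j hj
            rcases eq_or_ne j i with rfl | hji
            · have := hy j hj
              simp only [Pi.sub_apply, Pi.single_eq_same]
              lia
            · simpa [hji] using hx j hj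
          have := (hstep _ i hmem).2.2
          rw [sub_add_cancel] at this
          refine ⟨x - Pi.single i 1, hmem, this, haux _ ?_ ?_⟩
          · intro j hj
            simp [hj]
          · simp only [Pi.sub_apply, Pi.single_eq_same]
            lia
      refine le_trans ?_ (reachE_mul_le x x' y)
      refine le_trans ?_ (mul_le_mul' hstep' (ih x' y hx' hy hn'))
      rw [← ENNReal.ofReal_mul (Real.exp_pos _).le, ← Real.exp_add]
      refine ENNReal.ofReal_le_ofReal (Real.exp_le_exp.2 ?_)
      push_cast
      linarith
  intro x hx y hy
  rw [znorm_eq_natCast]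
  exact key _ x y hx hy rfl

end Reach
section Box

lemma le_tsum_kernE_mul_add {V : Type*} [AddCommGroup V] {m : V → ℝ≥0∞} {A : Set V}
    {e Ψ : V → ℝ≥0∞} {E : ℕ → V → ℝ≥0∞} (he : ∀ x, e x ≤ ∑' z, m (z - x) * e z)
    (hE : ∀ n x, ∑' z, m (z - x) * E n z ≤ E (n + 1) x)
    (hA : ∀ x ∈ A, e x ≤ Ψ x + E 0 x) (hA' : ∀ n, ∀ x ∉ A, e x ≤ E n x) (n : ℕ) (x : V) :
    e x ≤ ∑' y, kernE m A n x y * Ψ y + E n x := by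
  by_cases hx : x ∈ A
  swap
  · exact (hA' n x hx).trans le_add_self
  induction n generalizing x with
  | zero =>
    refine (hA x hx).trans (add_le_add_left ?_ _)
    calc Ψ x = kernE m A 0 x x * Ψ x := by rw [kernE_zero_self hx, one_mul]
      _ ≤ _ := ENNReal.le_tsum (f := fun y => kernE m A 0 x y * Ψ y) x
  | succ n ih =>
    have ih' : ∀ z, e z ≤ ∑' y, kernE m A n z y * Ψ y + E n z := fun z => by
      by_cases hz : z ∈ A
      · exact ih z hz
      · exact (hA' n z hz).trans le_add_self
    calc e x ≤ ∑' z, m (z - x) * e z := he x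
      _ ≤ ∑' z, m (z - x) * (∑' y, kernE m A n z y * Ψ y + E n z) :=
          ENNReal.tsum_le_tsum fun z => mul_le_mul_right (ih' z) _
      _ = ∑' y, kernE m A (n + 1) x y * Ψ y + ∑' z, m (z - x) * E n z := by
          simp_rw [mul_add]
          rw [ENNReal.tsum_add]
          congr 1
          simp_rw [kernE_succ_of_mem hx, ← ENNReal.tsum_mul_left, ← ENNReal.tsum_mul_right]
          rw [ENNReal.tsum_comm]
          simp_rw [mul_assoc]
      _ ≤ _ := add_le_add_right (hE n x) _

variable {d : ℕ} {μ : (Fin d → ℤ) → ℝ} {Λ : Set (Fin d)} {b : Fin d → ℝ} {r : ℝ}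

lemma tsum_step_mul_exp_le (hnn : ∀ z, 0 ≤ μ z) {a : Fin d → ℝ} {ρ : ℝ}
    (ha : phiE μ a ≤ ENNReal.ofReal (Real.exp ρ)) (κ : ℝ) (n : ℕ) (x : Fin d → ℤ) :
    ∑' z, muE μ (z - x) * ENNReal.ofReal (Real.exp (κ + ρ * n + dotZ a z))
      ≤ ENNReal.ofReal (Real.exp (κ + ρ * (n + 1 : ℕ) + dotZ a x)) := by
  have h : ∀ (s : ℝ) z, ENNReal.ofReal (Real.exp (s + dotZ a z))
      = ENNReal.ofReal (Real.exp s) * expE a z := fun s z => by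
    rw [Real.exp_add, ENNReal.ofReal_mul (Real.exp_pos _).le, expE]
  simp_rw [h, mul_left_comm _ (ENNReal.ofReal (Real.exp (κ + ρ * n)))]
  rw [ENNReal.tsum_mul_left, tsum_step_mul_expE hnn]
  calc _ ≤ ENNReal.ofReal (Real.exp (κ + ρ * n)) * (ENNReal.ofReal (Real.exp ρ) * expE a x) := by
        gcongr
    _ = _ := by
        rw [← mul_assoc, ← ENNReal.ofReal_mul (Real.exp_pos _).le, ← Real.exp_add]
        congr 3
        push_cast
        ring

lemma exists_phiE_single_le (hnn : ∀ z, 0 ≤ μ z) (hr : 0 < r)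
    (hb : Summable fun z => μ z * Real.exp (dotZ b z + r * znorm z)) (hφ : phiE μ b = 1) :
    ∃ C > 0, ∀ θ : ℝ, |θ| ≤ r / 2 → ∀ i, phiE μ (b + Pi.single i θ) ≤
      ENNReal.ofReal (Real.exp (θ * gradPhi μ b i + C * θ ^ 2)) := by
  obtain ⟨C, hC, h⟩ := exists_phiE_le hnn hr hb
  refine ⟨C, hC, fun θ hθ i => ?_⟩
  have hn : rnorm (Pi.single i θ : Fin d → ℝ) = |θ| := by
    rw [rnorm, Finset.sum_eq_single i]
    · simp
    · intro j _ hj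
      simp [hj]
    · simp
  refine (h _ (hn.le.trans hθ)).trans (ENNReal.ofReal_le_ofReal ?_)
  have hd : dotR (Pi.single i θ) (gradPhi μ b) = θ * gradPhi μ b i := by
    rw [dotR, Finset.sum_eq_single i]
    · simp
    · intro j _ hj
      simp [hj]
    · simp
  rw [hφ, hn, hd, sq_abs]
  have := Real.add_one_le_exp (θ * gradPhi μ b i + C * θ ^ 2)
  simp only [ENNReal.toReal_one]
  linarith

lemma dotZ_add_single (b : Fin d → ℝ) (i : Fin d) (θ : ℝ) (x : Fin d → ℤ) :
    dotZ (b + Pi.single i θ) x = dotZ b x + θ * x i := by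
  rw [dotZ_add_left, dotZ_single]

lemma exists_box_point (hnn : ∀ z, 0 ≤ μ z) (hr : 0 < r)
    (hb : Summable fun z => μ z * Real.exp (dotZ b z + r * znorm z)) (hφ : phiE μ b = 1)
    (hg : ∀ i ∈ Λ, 0 ≤ gradPhi μ b i) {η : ℝ} (hη : 0 < η) :
    ∃ T : ℕ, ∀ t ≥ T, ∃ y ∈ posDom Λ,
      (∀ j, |(y j : ℝ) - 1 - ⌈η * t⌉₊ - t * gradPhi μ b j| ≤ ⌈η * t⌉₊) ∧
      ENNReal.ofReal (Real.exp (dotZ b ((fun _ => 1 + (⌈η * t⌉₊ : ℤ)) - y) - 2 * d * ⌈η * t⌉₊ - 1))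
        ≤ reachE (muE μ) (posDom Λ) (fun _ => 1 + (⌈η * t⌉₊ : ℤ)) y := by
  obtain ⟨C, hC, hphi⟩ := exists_phiE_single_le hnn hr hb hφ
  set g := gradPhi μ b with hgdef
  set θ := min (r / 2) (η / (2 * C)) with hθdef
  have hθ : 0 < θ := lt_min (by positivity) (by positivity)
  have hθr : |θ| ≤ r / 2 := by rw [abs_of_pos hθ]; exact min_le_left _ _
  have hθr' : |-θ| ≤ r / 2 := by rwa [abs_neg]
  have hθη : C * θ ^ 2 ≤ θ * (η / 2) := by
    have : θ ≤ η / (2 * C) := min_le_right _ _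
    rw [le_div_iff₀ (by positivity)] at this
    nlinarith
  let ι := {i // i ∈ Λ} ⊕ (Fin d ⊕ Fin d)
  have htend : Tendsto (fun t : ℕ => (Fintype.card ι : ℝ) * Real.exp (-(θ * (η / 2) * t)))
      atTop (𝓝 0) := by
    have h1 : Tendsto (fun t : ℕ => θ * (η / 2) * (t : ℝ)) atTop atTop :=
      tendsto_natCast_atTop_atTop.const_mul_atTop (by positivity)
    simpa using (Real.tendsto_exp_neg_atTop_nhds_zero.comp h1).const_mul (Fintype.card ι : ℝ)
  obtain ⟨T, hT⟩ := eventually_atTop.1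
    (htend.eventually (gt_mem_nhds (by norm_num : (0 : ℝ) < 1 / 2)))
  refine ⟨T, fun t ht => ?_⟩
  set L := ⌈η * t⌉₊ with hL
  have hηL : η * t ≤ L := Nat.le_ceil _
  set x : Fin d → ℤ := fun _ => 1 + (L : ℤ) with hx
  set u : Fin d → ℝ := fun j => 1 + L + t * g j with hu
  let box : Finset (Fin d → ℤ) :=
    Fintype.piFinset fun j => Finset.Icc ⌈u j - L⌉ ⌊u j + L⌋
  have hbox : ∀ y, y ∈ box ↔ ∀ j, u j - L ≤ y j ∧ (y j : ℝ) ≤ u j + L := by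
    intro y
    simp only [box, Fintype.mem_piFinset, Finset.mem_Icc, Int.ceil_le, Int.le_floor]
  have hcard : (box.card : ℝ) ≤ Real.exp (2 * d * L) := by
    have h1 : ∀ j, (((Finset.Icc ⌈u j - L⌉ ⌊u j + L⌋).card : ℕ) : ℝ) ≤ Real.exp (2 * L) := by
      intro j
      rw [Int.card_Icc]
      refine le_trans ?_ (Real.add_one_le_exp (2 * (L : ℝ)))
      have h2 := Int.le_ceil (u j - L)
      have h3 := Int.floor_le (u j + L)
      rcases le_total 0 (⌊u j + L⌋ + 1 - ⌈u j - L⌉) with h | h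
      · have : (((⌊u j + L⌋ + 1 - ⌈u j - L⌉).toNat : ℤ) : ℝ) = ⌊u j + L⌋ + 1 - ⌈u j - L⌉ := by
          rw [Int.toNat_of_nonneg h]; push_cast; ring
        rw [Int.cast_natCast] at this
        rw [this]
        linarith
      · rw [Int.toNat_of_nonpos h]
        simp only [Nat.cast_zero]
        positivity
    calc (box.card : ℝ) = ∏ j : Fin d, (((Finset.Icc ⌈u j - L⌉ ⌊u j + L⌋).card : ℕ) : ℝ) := by
          rw [Fintype.card_piFinset]; push_cast; rfl
      _ ≤ ∏ _j : Fin d, Real.exp (2 * L) :=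
          Finset.prod_le_prod (fun _ _ => Nat.cast_nonneg _) fun j _ => h1 j
      _ = _ := by
          rw [Finset.prod_const, ← Real.exp_nat_mul]
          simp only [Finset.card_univ, Fintype.card_fin]
          congr 1
          ring
  let a : ι → Fin d → ℝ :=
    Sum.elim (fun i => b + Pi.single i.1 (-θ))
      (Sum.elim (fun j => b + Pi.single j θ) fun j => b + Pi.single j (-θ))
  let κ : ι → ℝ := Sum.elim (fun _ => 0)
    (Sum.elim (fun j => -(θ * (u j + L))) fun j => θ * (u j - L))
  let ρ : ι → ℝ := Sum.elim (fun _ => C * θ ^ 2)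
    (Sum.elim (fun j => θ * g j + C * θ ^ 2) fun j => -θ * g j + C * θ ^ 2)
  let F : ι → ℕ → (Fin d → ℤ) → ℝ≥0∞ :=
    fun k n y => ENNReal.ofReal (Real.exp (κ k + ρ k * n + dotZ (a k) y))
  have hρ : ∀ k, phiE μ (a k) ≤ ENNReal.ofReal (Real.exp (ρ k)) := by
    rintro (⟨i, hi⟩ | j | j)
    · refine (hphi _ hθr' i).trans (ENNReal.ofReal_le_ofReal (Real.exp_le_exp.2 ?_))
      simp only [ρ, Sum.elim_inl]
      have := mul_nonneg hθ.le (hg i hi)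
      nlinarith
    · exact hphi _ hθr j
    · refine (hphi _ hθr' j).trans (ENNReal.ofReal_le_ofReal (Real.exp_le_exp.2 ?_))
      simp [ρ]
  have hFE : ∀ k n y, F k n y ≤ ∑ k, F k n y := fun k n y =>
    Finset.single_le_sum (f := fun k => F k n y) (fun _ _ => zero_le) (Finset.mem_univ k)
  have key := le_tsum_kernE_mul_add (m := muE μ) (A := posDom Λ) (e := expE b)
    (Ψ := fun y => if y ∈ box then expE b y else 0) (E := fun n y => ∑ k, F k n y)
    (fun y => by rw [tsum_step_mul_expE hnn, hφ, one_mul])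
    (fun n y => by
      simp_rw [Finset.mul_sum]
      rw [Summable.tsum_finsetSum fun _ _ => ENNReal.summable]
      exact Finset.sum_le_sum fun k _ => tsum_step_mul_exp_le hnn (hρ k) (κ k) n y)
    (fun y _ => by
      by_cases hy : y ∈ box
      · simp [hy]
      · simp only [hy, if_false, zero_add]
        rw [hbox] at hy
        push Not at hy
        obtain ⟨j, hj⟩ := hy
        by_cases hlow : u j - L ≤ y j
        · refine le_trans ?_ (hFE (Sum.inr (Sum.inl j)) 0 y)
          refine ENNReal.ofReal_le_ofReal (Real.exp_le_exp.2 ?_)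
          simp only [κ, ρ, a, Sum.elim_inr, Sum.elim_inl, dotZ_add_single]
          have := mul_le_mul_of_nonneg_left (hj hlow).le hθ.le
          push_cast
          linarith
        · refine le_trans ?_ (hFE (Sum.inr (Sum.inr j)) 0 y)
          refine ENNReal.ofReal_le_ofReal (Real.exp_le_exp.2 ?_)
          simp only [κ, ρ, a, Sum.elim_inr, dotZ_add_single]
          have := mul_le_mul_of_nonneg_left (not_le.1 hlow).le hθ.le
          push_cast
          linarith)
    (fun n y hy => by
      simp only [posDom, Set.mem_ofPred_eq, not_forall] at hy
      obtain ⟨i, hi, hyi⟩ := hy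
      refine le_trans ?_ (hFE (Sum.inl ⟨i, hi⟩) n y)
      refine ENNReal.ofReal_le_ofReal (Real.exp_le_exp.2 ?_)
      simp only [κ, ρ, a, Sum.elim_inl, dotZ_add_single]
      have h1 : (y i : ℝ) ≤ 0 := by exact_mod_cast not_lt.1 hyi
      have h2 : 0 ≤ C * θ ^ 2 * n := by positivity
      nlinarith)
    t x
  have hErr : ∑ k, F k t x ≤ ENNReal.ofReal (1 / 2) * expE b x := by
    have h1 : ∀ k, F k t x ≤ ENNReal.ofReal (Real.exp (-(θ * (η / 2) * t))) * expE b x := by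
      intro k
      rw [expE, ← ENNReal.ofReal_mul (Real.exp_pos _).le, ← Real.exp_add]
      refine ENNReal.ofReal_le_ofReal (Real.exp_le_exp.2 ?_)
      have h2 : C * θ ^ 2 * t ≤ θ * (η / 2) * t := by gcongr
      have h3 : θ * (η * t) ≤ θ * L := by gcongr
      rcases k with ⟨i, hi⟩ | j | j
      · simp only [κ, ρ, a, Sum.elim_inl, dotZ_add_single, hx]
        push_cast
        nlinarith
      · simp only [κ, ρ, a, Sum.elim_inr, Sum.elim_inl, dotZ_add_single, hx, hu]
        push_cast
        nlinarith
      · simp only [κ, ρ, a, Sum.elim_inr, dotZ_add_single, hx, hu]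
        push_cast
        nlinarith
    calc ∑ k, F k t x
        ≤ ∑ _k : ι, ENNReal.ofReal (Real.exp (-(θ * (η / 2) * t))) * expE b x :=
          Finset.sum_le_sum fun k _ => h1 k
      _ = ENNReal.ofReal (Fintype.card ι * Real.exp (-(θ * (η / 2) * t))) * expE b x := by
          rw [Finset.sum_const, nsmul_eq_mul, ← mul_assoc, ENNReal.ofReal_mul (Nat.cast_nonneg _),
            ENNReal.ofReal_natCast, Finset.card_univ]
      _ ≤ _ := by
          gcongr
          exact (hT t ht).le
  obtain ⟨y, hy, hky⟩ : ∃ y ∈ box, ENNReal.ofReal (Real.exp (-(2 * d * L) - 1)) * expE b x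
      ≤ kernE (muE μ) (posDom Λ) t x y * expE b y := by
    by_contra! hcon
    have h1 : ∑' y, kernE (muE μ) (posDom Λ) t x y * (if y ∈ box then expE b y else 0)
        ≤ ENNReal.ofReal (Real.exp (-1)) * expE b x := by
      rw [tsum_eq_sum (s := box) (fun y hy => by simp [hy])]
      calc _ ≤ ∑ _y ∈ box, ENNReal.ofReal (Real.exp (-(2 * d * L) - 1)) * expE b x :=
            Finset.sum_le_sum fun y hy => by simpa [hy] using (hcon y hy).le
        _ = ENNReal.ofReal (box.card * Real.exp (-(2 * d * L) - 1)) * expE b x := by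
            rw [Finset.sum_const, nsmul_eq_mul, ← mul_assoc,
              ENNReal.ofReal_mul (Nat.cast_nonneg _), ENNReal.ofReal_natCast]
        _ ≤ _ := by
            gcongr
            calc _ ≤ Real.exp (2 * d * L) * Real.exp (-(2 * d * L) - 1) := by gcongr
              _ = _ := by rw [← Real.exp_add]; congr 1; ring
    have h2 := key.trans (add_le_add h1 hErr)
    rw [← add_mul, ← ENNReal.ofReal_add (Real.exp_pos _).le (by norm_num)] at h2
    have h3 : ENNReal.ofReal (Real.exp (-1) + 1 / 2) < 1 := by
      rw [ENNReal.ofReal_lt_one]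
      have := Real.exp_neg_one_lt_d9
      linarith
    have h4 := ENNReal.mul_lt_mul_left (expE_ne_zero b x) (expE_ne_top b x) h3
    rw [one_mul] at h4
    exact absurd h2 (not_le.2 h4)
  have hyA : y ∈ posDom Λ := by
    by_contra hyA
    rw [kernE_right_notMem hyA, zero_mul, nonpos_iff_eq_zero, mul_eq_zero] at hky
    rcases hky with h | h
    · rw [ENNReal.ofReal_eq_zero] at h
      exact absurd (Real.exp_pos _) (not_lt.2 h)
    · exact expE_ne_zero _ _ h
  refine ⟨y, hyA, fun j => ?_, le_trans ?_ (kernE_le_reachE t x y)⟩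
  · have := (hbox y).1 hy j
    rw [abs_le]
    simp only [hu] at this
    constructor <;> linarith
  · rw [← ENNReal.mul_le_mul_iff_left (expE_ne_zero b y) (expE_ne_top b y)]
    refine le_trans (le_of_eq ?_) hky
    simp only [expE]
    rw [← ENNReal.ofReal_mul (Real.exp_pos _).le, ← ENNReal.ofReal_mul (Real.exp_pos _).le,
      ← Real.exp_add, ← Real.exp_add, dotZ_sub_right]
    congr 2
    ring

end Box
section LowerBound

variable {d : ℕ} {μ : (Fin d → ℤ) → ℝ} {Λ : Set (Fin d)} {b : Fin d → ℝ} {r : ℝ}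

lemma znorm_le_of_abs_le {ι : Type*} [Fintype ι] {z : ι → ℤ} {f : ι → ℝ}
    (h : ∀ i, |(z i : ℝ)| ≤ f i) : znorm z ≤ ∑ i, f i :=
  Finset.sum_le_sum fun i _ => h i

lemma exists_exp_le_reachE_of_near (hnn : ∀ z, 0 ≤ μ z) (hirr : Irred μ (posDom Λ)) (hr : 0 < r)
    (hb : Summable fun z => μ z * Real.exp (dotZ b z + r * znorm z)) (hφ : phiE μ b = 1)
    (hg : ∀ i ∈ Λ, 0 ≤ gradPhi μ b i) {ε : ℝ} (hε : 0 < ε) :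
    ∃ δ > 0, ∃ T : ℕ, ∀ t ≥ T, ∀ z : Fin d → ℤ, (∀ i ∈ Λ, 0 ≤ z i) →
      ∑ i, |(z i : ℝ) - t * gradPhi μ b i| ≤ δ * t →
      ENNReal.ofReal (Real.exp (-dotZ b z - ε * t)) ≤ reachE (muE μ) (posDom Λ) 1 (1 + z) := by
  obtain ⟨Γ, hΓ, hreach⟩ := exists_exp_le_reachE hirr
  have hbn := rnorm_nonneg b
  set K : ℝ := (Γ + rnorm b) * (1 + 3 * d) + 2 * d with hK
  have hK0 : 0 ≤ K := by positivity
  set η : ℝ := ε / (2 * (K + 1)) with hηdef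
  have hη : 0 < η := by positivity
  have hηK : η * (K + 1) = ε / 2 := by rw [hηdef]; field_simp
  obtain ⟨T, hT⟩ := exists_box_point hnn hr hb hφ hg hη
  obtain ⟨T', hT'⟩ := exists_nat_ge (2 * (K + 1) / ε)
  refine ⟨η, hη, max T T', fun t ht z hz hzt => ?_⟩
  obtain ⟨y, hy, hyb, hreach'⟩ := hT t (le_of_max_le_left ht)
  have htT' : 2 * (K + 1) / ε ≤ t := hT'.trans (by exact_mod_cast le_of_max_le_right ht)
  rw [div_le_iff₀ hε] at htT'
  set L := ⌈η * t⌉₊ with hL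
  have hLη : (L : ℝ) ≤ η * t + 1 := (Nat.ceil_lt_add_one (by positivity)).le
  set x : Fin d → ℤ := fun _ => 1 + (L : ℤ) with hx
  have hxA : x ∈ posDom Λ := fun i _ => by simp only [hx]; positivity
  have hzA : 1 + z ∈ posDom Λ := add_mem_posDom hz 1 one_mem_posDom
  have hn1 : znorm (x - 1) ≤ d * L := by
    refine (znorm_le_of_abs_le (f := fun _ => (L : ℝ)) fun i => ?_).trans (by simp)
    simp [hx]
  have hn2 : znorm (1 + z - y) ≤ η * t + d * (2 * L) := by
    refine (znorm_le_of_abs_le (f := fun i => |(z i : ℝ) - t * gradPhi μ b i| + 2 * L)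
      fun i => ?_).trans ?_
    · have h1 := abs_le.1 (hyb i)
      have h2 := abs_le.1 (le_refl |(z i : ℝ) - t * gradPhi μ b i|)
      simp only [Pi.sub_apply, Pi.add_apply, Pi.one_apply]
      push_cast
      have : (0 : ℝ) ≤ L := Nat.cast_nonneg _
      rw [abs_le]
      constructor <;> linarith
    · rw [Finset.sum_add_distrib]
      simpa using hzt
  have hn3 : znorm (x + z - y) ≤ η * t + d * L := by
    refine (znorm_le_of_abs_le (f := fun i => |(z i : ℝ) - t * gradPhi μ b i| + L)
      fun i => ?_).trans ?_
    · have h1 := abs_le.1 (hyb i)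
      have h2 := abs_le.1 (le_refl |(z i : ℝ) - t * gradPhi μ b i|)
      simp only [Pi.sub_apply, Pi.add_apply, hx]
      push_cast
      rw [abs_le]
      constructor <;> linarith
    · rw [Finset.sum_add_distrib]
      simpa using hzt
  have hdot : -dotZ b z - rnorm b * (η * t + d * L) ≤ dotZ b (x - y) := by
    have h1 := (abs_le.1 (abs_dotZ_le b (x + z - y))).1
    have h2 := mul_le_mul_of_nonneg_left hn3 hbn
    rw [show x - y = (x + z - y) - z by abel, dotZ_sub_right]
    linarith
  have h1 := hreach 1 one_mem_posDom x hxA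
  have h3 := hreach y hy (1 + z) hzA
  refine le_trans ?_ ((mul_le_mul' (mul_le_mul' h1 hreach') h3).trans
    ((mul_le_mul' (reachE_mul_le 1 x y) le_rfl).trans (reachE_mul_le 1 y (1 + z))))
  rw [← ENNReal.ofReal_mul (Real.exp_pos _).le, ← Real.exp_add,
    ← ENNReal.ofReal_mul (by positivity), ← Real.exp_add]
  refine ENNReal.ofReal_le_ofReal (Real.exp_le_exp.2 ?_)
  have h4 := mul_le_mul_of_nonneg_left hn1 hΓ
  have h5 := mul_le_mul_of_nonneg_left hn2 hΓ
  have h6 : ((Γ + rnorm b) * (3 * d) + 2 * d) * L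
      ≤ ((Γ + rnorm b) * (3 * d) + 2 * d) * (η * t + 1) := by gcongr
  have h7 : 0 ≤ rnorm b * (d * L) := by positivity
  have h8 : 0 ≤ rnorm b * (d * 2 * L) := by positivity
  have h9 : 0 ≤ Γ + rnorm b := by positivity
  have h10 : 0 ≤ η * t := by positivity
  have h11 : K * (η * t) + (η * t) = ε / 2 * t := by rw [← hηK]; ring
  nlinarith

lemma exists_exp_le_reachE_of_direction (hnn : ∀ z, 0 ≤ μ z) (hirr : Irred μ (posDom Λ))
    (hr : 0 < r) (hb : Summable fun z => μ z * Real.exp (dotZ b z + r * znorm z))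
    (hφ : phiE μ b = 1) {κ : ℝ} (hκ : 0 < κ) {ζ : Fin d → ℝ} (hζ : ∀ i ∈ Λ, 0 ≤ ζ i)
    (hg : gradPhi μ b = κ • ζ) {ε : ℝ} (hε : 0 < ε) :
    ∃ δ > 0, ∃ N : ℝ, ∀ z : Fin d → ℤ, (∀ i ∈ Λ, 0 ≤ z i) → N ≤ znorm z →
      ∑ i, |(z i : ℝ) - znorm z * ζ i| ≤ δ * znorm z →
      ENNReal.ofReal (Real.exp (-dotZ b z - ε * znorm z))
        ≤ reachE (muE μ) (posDom Λ) 1 (1 + z) := by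
  obtain ⟨δ, hδ, T, hT⟩ := exists_exp_le_reachE_of_near (Λ := Λ) hnn hirr hr hb hφ
    (fun i hi => by rw [hg]; exact mul_nonneg hκ.le (hζ i hi))
    (ε := ε * κ / 2) (by positivity)
  have hgn := rnorm_nonneg (gradPhi μ b)
  refine ⟨δ / (2 * κ), by positivity,
    max (κ * T) (max κ (2 * κ * rnorm (gradPhi μ b) / δ)), fun z hz hN hsum => ?_⟩
  have hN1 : κ * T ≤ znorm z := (le_max_left _ _).trans hN
  have hN2 : κ ≤ znorm z := (le_max_left _ _).trans ((le_max_right _ _).trans hN)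
  have hN3 : 2 * κ * rnorm (gradPhi μ b) / δ ≤ znorm z :=
    (le_max_right _ _).trans ((le_max_right _ _).trans hN)
  rw [div_le_iff₀ hδ] at hN3
  set t := ⌈znorm z / κ⌉₊ with ht
  have ht1 : znorm z / κ ≤ t := Nat.le_ceil _
  have ht2 : (t : ℝ) ≤ znorm z / κ + 1 :=
    (Nat.ceil_lt_add_one (div_nonneg (znorm_nonneg z) hκ.le)).le
  rw [div_le_iff₀ hκ] at ht1
  have ht3 : (t : ℝ) * κ ≤ znorm z + κ := by
    have := mul_le_mul_of_nonneg_right ht2 hκ.le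
    rwa [add_mul, div_mul_cancel₀ _ hκ.ne', one_mul] at this
  refine le_trans (ENNReal.ofReal_le_ofReal (Real.exp_le_exp.2 ?_)) (hT t ?_ z hz ?_)
  · nlinarith
  · have : κ * T ≤ κ * t := by linarith
    exact_mod_cast le_of_mul_le_mul_left this hκ
  · calc ∑ i, |(z i : ℝ) - t * gradPhi μ b i|
        ≤ ∑ i, (|(z i : ℝ) - znorm z * ζ i| + |gradPhi μ b i|) := by
          refine Finset.sum_le_sum fun i _ => ?_
          have h1 : (z i : ℝ) - t * gradPhi μ b i
              = ((z i : ℝ) - znorm z * ζ i) - (t - znorm z / κ) * gradPhi μ b i := by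
            rw [hg]
            simp only [Pi.smul_apply, smul_eq_mul]
            field_simp
            ring
          rw [h1]
          refine (abs_sub _ _).trans (add_le_add_right ?_ _)
          rw [abs_mul]
          refine mul_le_of_le_one_left (abs_nonneg _) ?_
          have : znorm z / κ ≤ t := Nat.le_ceil _
          rw [abs_le]
          constructor <;> linarith
      _ ≤ δ / (2 * κ) * znorm z + rnorm (gradPhi μ b) := by
          rw [Finset.sum_add_distrib]
          exact add_le_add_left hsum _
      _ ≤ δ * t := by
          have h2 : δ / (2 * κ) * znorm z ≤ δ / 2 * t := by
            rw [div_mul_eq_mul_div, div_le_iff₀ (by positivity)]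
            nlinarith
          have h3 : rnorm (gradPhi μ b) ≤ δ / 2 * t := by
            have h4 : 2 * κ * rnorm (gradPhi μ b) ≤ 2 * κ * (δ / 2 * t) := by nlinarith
            exact le_of_mul_le_mul_left h4 (by positivity)
          linarith

end LowerBound
section Gradient

variable {d : ℕ} {μ : (Fin d → ℤ) → ℝ} {Λ : Set (Fin d)} {b : Fin d → ℝ} {r : ℝ}

lemma dotR_eq_dotProduct (a q : Fin d → ℝ) : dotR a q = a ⬝ᵥ q := rfl

lemma dotProduct_self_pos_of_ne_zero {v : Fin d → ℝ} (hv : v ≠ 0) : 0 < v ⬝ᵥ v := by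
  simpa using Matrix.dotProduct_star_self_pos_iff.2 hv

lemma rnorm_smul {ι : Type*} [Fintype ι] (s : ℝ) (v : ι → ℝ) : rnorm (s • v) = |s| * rnorm v := by
  simp [rnorm, abs_mul, Finset.mul_sum]

lemma exists_phiE_add_smul_lt_one (hnn : ∀ z, 0 ≤ μ z) (hr : 0 < r)
    (hb : Summable fun z => μ z * Real.exp (dotZ b z + r * znorm z)) {v : Fin d → ℝ}
    (h : phiE μ b < 1 ∨ phiE μ b = 1 ∧ dotR v (gradPhi μ b) < 0) :
    ∃ s : ℝ, 0 < s ∧ phiE μ (b + s • v) < 1 := by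
  obtain ⟨C, hC, hle⟩ := exists_phiE_le hnn hr hb
  have hv := rnorm_nonneg v
  have h1 : ∀ᶠ s : ℝ in 𝓝[>] 0, rnorm (s • v) ≤ r / 2 := by
    have : Tendsto (fun s : ℝ => |s| * rnorm v) (𝓝[>] 0) (𝓝 (|0| * rnorm v)) :=
      (Continuous.tendsto (by fun_prop) _).mono_left nhdsWithin_le_nhds
    rw [abs_zero, zero_mul] at this
    filter_upwards [this.eventually (gt_mem_nhds (by positivity : 0 < r / 2))] with s hs
    rw [rnorm_smul]
    exact hs.le
  have h2 : ∀ᶠ s : ℝ in 𝓝[>] 0,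
      (phiE μ b).toReal + dotR (s • v) (gradPhi μ b) + C * rnorm (s • v) ^ 2 < 1 := by
    simp only [rnorm_smul, dotR_eq_dotProduct, smul_dotProduct, smul_eq_mul]
    rcases h with h | ⟨h, hd⟩
    · have : Tendsto (fun s : ℝ => (phiE μ b).toReal + s * (v ⬝ᵥ gradPhi μ b)
          + C * (|s| * rnorm v) ^ 2) (𝓝[>] 0)
          (𝓝 ((phiE μ b).toReal + 0 * (v ⬝ᵥ gradPhi μ b) + C * (|0| * rnorm v) ^ 2)) :=
        (Continuous.tendsto (by fun_prop) _).mono_left nhdsWithin_le_nhds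
      refine this.eventually (gt_mem_nhds ?_)
      have := ENNReal.toReal_lt_toReal h.ne_top ENNReal.one_ne_top |>.2 h
      simpa using this
    · have : Tendsto (fun s : ℝ => (v ⬝ᵥ gradPhi μ b) + C * (s * rnorm v ^ 2)) (𝓝[>] 0)
          (𝓝 ((v ⬝ᵥ gradPhi μ b) + C * (0 * rnorm v ^ 2))) :=
        (Continuous.tendsto (by fun_prop) _).mono_left nhdsWithin_le_nhds
      rw [zero_mul, mul_zero, add_zero] at this
      filter_upwards [this.eventually (gt_mem_nhds hd), self_mem_nhdsWithin] with s hs hs0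
      have hs0 : 0 < s := hs0
      rw [h, ENNReal.toReal_one, abs_of_pos hs0]
      nlinarith
  obtain ⟨s, ⟨hs1, hs2⟩, hs0⟩ := ((h1.and h2).and self_mem_nhdsWithin).exists
  exact ⟨s, hs0, (hle _ hs1).trans_lt (ENNReal.ofReal_lt_one.2 hs2)⟩

lemma exists_phiE_smul_lt_one (hnn : ∀ z, 0 ≤ μ z) (hsum : HasSum μ 1) (hr : 0 < r)
    (hb : Summable fun z => μ z * Real.exp (dotZ 0 z + r * znorm z)) (hM : Mvec μ ≠ 0) :
    ∃ a, phiE μ a < 1 := by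
  obtain ⟨s, -, hs⟩ := exists_phiE_add_smul_lt_one (v := -Mvec μ) hnn hr hb
    (Or.inr ⟨phiE_zero hnn hsum, by
      rw [gradPhi_zero, dotR_eq_dotProduct, neg_dotProduct, neg_lt_zero]
      exact dotProduct_self_pos_of_ne_zero hM⟩)
  exact ⟨_, hs⟩

lemma exists_gradPhi_eq_smul (hnn : ∀ z, 0 ≤ μ z) (hsum : HasSum μ 1)
    (hirr : Irred μ (posDom (∅ : Set (Fin d)))) (hr : 0 < r)
    (hb : ∀ b ∈ Dset μ, Summable fun z => μ z * Real.exp (dotZ b z + r * znorm z))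
    (hM : Mvec μ ≠ 0) {ζ : Fin d → ℝ} (hζ : ζ ≠ 0) :
    ∃ b ∈ Dset μ, phiE μ b = 1 ∧ ∃ κ : ℝ, 0 < κ ∧ gradPhi μ b = κ • ζ := by
  have h0 : (0 : Fin d → ℝ) ∈ Dset μ := (phiE_zero hnn hsum).le
  have hζζ : 0 < ζ ⬝ᵥ ζ := dotProduct_self_pos_of_ne_zero hζ
  obtain ⟨b, hbD, hmax⟩ := (isCompact_Dset hirr).exists_isMaxOn ⟨0, h0⟩
    (f := fun b => b ⬝ᵥ ζ) (by unfold dotProduct; fun_prop)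
  have hbD' : phiE μ b ≤ 1 := hbD
  have hmax' : ∀ s : ℝ, 0 < s → ∀ v : Fin d → ℝ, phiE μ (b + s • v) < 1 → v ⬝ᵥ ζ ≤ 0 := by
    intro s hs v hv
    have h1 : (b + s • v) ⬝ᵥ ζ ≤ b ⬝ᵥ ζ := hmax (show b + s • v ∈ Dset μ from hv.le)
    rw [add_dotProduct, smul_dotProduct, smul_eq_mul] at h1
    by_contra! h2
    have := mul_pos hs h2
    linarith
  have hφ : phiE μ b = 1 := by
    by_contra hne
    obtain ⟨s, hs, hlt⟩ := exists_phiE_add_smul_lt_one (v := ζ) hnn hr (hb b hbD)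
      (Or.inl (lt_of_le_of_ne hbD' hne))
    exact absurd (hmax' s hs ζ hlt) (not_le.2 hζζ)
  have hcone : ∀ v : Fin d → ℝ, v ⬝ᵥ gradPhi μ b < 0 → v ⬝ᵥ ζ ≤ 0 := by
    intro v hv
    obtain ⟨s, hs, hlt⟩ := exists_phiE_add_smul_lt_one hnn hr (hb b hbD) (Or.inr ⟨hφ, hv⟩)
    exact hmax' s hs v hlt
  have hg : gradPhi μ b ≠ 0 := by
    intro hg
    obtain ⟨a, ha⟩ := exists_phiE_smul_lt_one hnn hsum hr (hb 0 h0) hM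
    have := le_phiE hnn hr (hb b hbD) (a - b)
    rw [hg, add_sub_cancel, hφ, dotR_eq_dotProduct, dotProduct_zero] at this
    simp only [ENNReal.toReal_one, add_zero, ENNReal.ofReal_one] at this
    exact absurd ha (not_lt.2 this)
  set g := gradPhi μ b with hgdef
  set κ := g ⬝ᵥ ζ / (ζ ⬝ᵥ ζ) with hκ
  set w := g - κ • ζ with hw
  have hwζ : w ⬝ᵥ ζ = 0 := by
    rw [hw, sub_dotProduct, smul_dotProduct, smul_eq_mul, hκ, div_mul_cancel₀ _ hζζ.ne', sub_self]
  have hwg : w ⬝ᵥ g = w ⬝ᵥ w := by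
    have : g = w + κ • ζ := by rw [hw]; abel
    conv_lhs => rw [this]
    rw [dotProduct_add, dotProduct_smul, hwζ, smul_zero, add_zero]
  have hw0 : w = 0 := by
    by_contra hne
    have hww : 0 < w ⬝ᵥ w := dotProduct_self_pos_of_ne_zero hne
    set s := (w ⬝ᵥ w) / (2 * (|ζ ⬝ᵥ g| + 1)) with hs
    have hs0 : 0 < s := by positivity
    have h1 := hcone (s • ζ - w) (by
      rw [sub_dotProduct, smul_dotProduct, smul_eq_mul, hwg]
      have h2 : s * (ζ ⬝ᵥ g) ≤ s * (|ζ ⬝ᵥ g| + 1) := by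
        gcongr
        exact (le_abs_self _).trans (by linarith)
      have h3 : s * (|ζ ⬝ᵥ g| + 1) = (w ⬝ᵥ w) / 2 := by rw [hs]; field_simp
      linarith)
    rw [sub_dotProduct, smul_dotProduct, smul_eq_mul, hwζ, sub_zero] at h1
    exact absurd h1 (not_le.2 (mul_pos hs0 hζζ))
  have hgκ : g = κ • ζ := by rw [← sub_eq_zero, ← hw, hw0]
  refine ⟨b, hbD, hφ, κ, ?_, hgκ⟩
  rcases lt_trichotomy κ 0 with h | h | h
  · have := hcone ζ (by
      rw [hgκ, dotProduct_smul, smul_eq_mul]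
      exact mul_neg_of_neg_of_pos h hζζ)
    exact absurd this (not_le.2 hζζ)
  · rw [h, zero_smul] at hgκ
    exact absurd hgκ hg
  · exact h

lemma isCompact_unit_cone : IsCompact {ζ : Fin d → ℝ | rnorm ζ = 1 ∧ ∀ i ∈ Λ, 0 ≤ ζ i} := by
  refine Metric.isCompact_of_isClosed_isBounded ?_ ?_
  · refine IsClosed.inter (isClosed_eq (by unfold rnorm; fun_prop) continuous_const) ?_
    have : {ζ : Fin d → ℝ | ∀ i ∈ Λ, 0 ≤ ζ i} = ⋂ i ∈ Λ, {ζ | 0 ≤ ζ i} := by ext; simp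
    change IsClosed {ζ : Fin d → ℝ | ∀ i ∈ Λ, 0 ≤ ζ i}
    rw [this]
    exact isClosed_biInter fun i _ => isClosed_le continuous_const (continuous_apply i)
  · refine (Metric.isBounded_closedBall (x := (0 : Fin d → ℝ)) (r := 1)).subset fun ζ hζ => ?_
    rw [mem_closedBall_zero_iff, pi_norm_le_iff_of_nonneg zero_le_one]
    exact fun i => (abs_le_rnorm ζ i).trans hζ.1.le

lemma exists_finite_exp_le_reachE (hnn : ∀ z, 0 ≤ μ z) (hsum : HasSum μ 1) (hA1 : A1 μ)
    (hr : 0 < r) (hb : ∀ b ∈ Dset μ, Summable fun z => μ z * Real.exp (dotZ b z + r * znorm z))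
    (hM : Mvec μ ≠ 0) {ε : ℝ} (hε : 0 < ε) :
    ∃ B : Finset (Fin d → ℝ), (∀ b ∈ B, b ∈ Dset μ) ∧ ∃ N : ℝ, ∀ z : Fin d → ℤ,
      (∀ i ∈ Λ, 0 ≤ z i) → N ≤ znorm z → ∃ b ∈ B,
        ENNReal.ofReal (Real.exp (-dotZ b z - ε * znorm z))
          ≤ reachE (muE μ) (posDom Λ) 1 (1 + z) := by
  have hex : ∀ ζ : Fin d → ℝ, ∃ b ∈ Dset μ, ∃ δ > 0, ∃ N : ℝ,
      (rnorm ζ = 1 ∧ ∀ i ∈ Λ, 0 ≤ ζ i) → ∀ z : Fin d → ℤ,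
      (∀ i ∈ Λ, 0 ≤ z i) → N ≤ znorm z → ∑ i, |(z i : ℝ) - znorm z * ζ i| ≤ δ * znorm z →
      ENNReal.ofReal (Real.exp (-dotZ b z - ε * znorm z))
        ≤ reachE (muE μ) (posDom Λ) 1 (1 + z) := by
    intro ζ
    by_cases hζ : rnorm ζ = 1 ∧ ∀ i ∈ Λ, 0 ≤ ζ i
    · have hζ0 : ζ ≠ 0 := by
        rintro rfl
        simp [rnorm] at hζ
      obtain ⟨b, hbD, hφ, κ, hκ, hg⟩ := exists_gradPhi_eq_smul hnn hsum (hA1 ∅) hr hb hM hζ0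
      obtain ⟨δ, hδ, N, h⟩ := exists_exp_le_reachE_of_direction hnn (hA1 Λ) hr (hb b hbD) hφ hκ
        hζ.2 hg hε
      exact ⟨b, hbD, δ, hδ, N, fun _ => h⟩
    · exact ⟨0, (phiE_zero hnn hsum).le, 1, one_pos, 0, fun h => absurd h hζ⟩
  choose b hbD δ hδ N h using hex
  obtain ⟨S, hS, hcov⟩ := (isCompact_unit_cone (Λ := Λ)).elim_nhds_subcover
    (fun ζ => {ζ' : Fin d → ℝ | ∑ i, |ζ' i - ζ i| < δ ζ}) fun ζ _ => by
      refine IsOpen.mem_nhds (isOpen_lt (by fun_prop) continuous_const) ?_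
      simpa using hδ ζ
  refine ⟨S.image b, fun a ha => ?_, 1 + ∑ ζ ∈ S, |N ζ|, fun z hz hN => ?_⟩
  · obtain ⟨ζ, -, rfl⟩ := Finset.mem_image.1 ha
    exact hbD ζ
  have hpos : 0 < znorm z := by
    have : 0 ≤ ∑ ζ ∈ S, |N ζ| := Finset.sum_nonneg fun _ _ => abs_nonneg _
    linarith
  have hmem : (fun i => (z i : ℝ) / znorm z) ∈
      {ζ : Fin d → ℝ | rnorm ζ = 1 ∧ ∀ i ∈ Λ, 0 ≤ ζ i} := by
    constructor
    · simp only [rnorm, abs_div, abs_of_pos hpos]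
      rw [← Finset.sum_div]
      exact div_self hpos.ne'
    · intro i hi
      have := hz i hi
      positivity
  obtain ⟨ζ, hζS, hζ⟩ := Set.mem_iUnion₂.1 (hcov hmem)
  refine ⟨b ζ, Finset.mem_image_of_mem b hζS, h ζ (hS ζ hζS) z hz ?_ ?_⟩
  · have h1 : |N ζ| ≤ ∑ ζ ∈ S, |N ζ| :=
      Finset.single_le_sum (f := fun ζ => |N ζ|) (fun _ _ => abs_nonneg _) hζS
    linarith [le_abs_self (N ζ)]
  · have hζ' : ∑ i, |(z i : ℝ) / znorm z - ζ i| < δ ζ := hζ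
    calc ∑ i, |(z i : ℝ) - znorm z * ζ i|
        = ∑ i, |(z i : ℝ) / znorm z - ζ i| * znorm z := by
          refine Finset.sum_congr rfl fun i _ => ?_
          rw [← abs_of_pos hpos, ← abs_mul, abs_of_pos hpos]
          congr 1
          field_simp
      _ ≤ _ := by
          rw [← Finset.sum_mul]
          exact mul_le_mul_of_nonneg_right hζ'.le hpos.le

/-- The Green function at `1 + z` is bounded by the one at `1`, up to a factor which is a finite
sum of exponentials. -/
lemma exists_greenE_le (hnn : ∀ z, 0 ≤ μ z) (hsum : HasSum μ 1) (hA1 : A1 μ)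
    (hr : 0 < r) (hb : ∀ b ∈ Dset μ, Summable fun z => μ z * Real.exp (dotZ b z + r * znorm z))
    (hM : Mvec μ ≠ 0) {ε : ℝ} (hε : 0 < ε) :
    ∃ B : Finset (Fin d → ℝ), (∀ b ∈ B, b ∈ Dset μ) ∧ ∃ c : ℝ, ∀ z : Fin d → ℤ,
      (∀ i ∈ Λ, 0 ≤ z i) → ∀ y, greenE (muE μ) (posDom Λ) (1 + z) y ≤
        ENNReal.ofReal (Real.exp c + ∑ b ∈ B, Real.exp (dotZ b z + ε * znorm z))
          * greenE (muE μ) (posDom Λ) 1 y := by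
  obtain ⟨B, hB, N, h⟩ := exists_finite_exp_le_reachE (Λ := Λ) hnn hsum hA1 hr hb hM hε
  obtain ⟨Γ, hΓ, hΓ'⟩ := exists_exp_le_reachE (hA1 Λ)
  refine ⟨B, hB, Γ * N, fun z hz y => ?_⟩
  have hex : ∃ s : ℝ, s ≤ Real.exp (Γ * N) + ∑ b ∈ B, Real.exp (dotZ b z + ε * znorm z) ∧
      1 ≤ ENNReal.ofReal s * reachE (muE μ) (posDom Λ) 1 (1 + z) := by
    have hone : ∀ {a a' : ℝ}, a + a' = 0 →
        1 ≤ ENNReal.ofReal (Real.exp a) * ENNReal.ofReal (Real.exp a') := fun {a a'} haa => by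
      rw [← ENNReal.ofReal_mul (Real.exp_pos _).le, ← Real.exp_add, haa]
      simp
    have hsum0 : 0 ≤ ∑ b ∈ B, Real.exp (dotZ b z + ε * znorm z) :=
      Finset.sum_nonneg fun _ _ => (Real.exp_pos _).le
    rcases le_total N (znorm z) with hN | hN
    · obtain ⟨b, hbB, hle⟩ := h z hz hN
      refine ⟨Real.exp (dotZ b z + ε * znorm z), ?_,
        (hone (by ring)).trans (mul_le_mul_right hle _)⟩
      have := Finset.single_le_sum (f := fun b => Real.exp (dotZ b z + ε * znorm z))
        (fun _ _ => (Real.exp_pos _).le) hbB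
      linarith [Real.exp_pos (Γ * N)]
    · have hle := hΓ' 1 one_mem_posDom (1 + z) (add_mem_posDom hz 1 one_mem_posDom)
      rw [add_sub_cancel_left] at hle
      refine ⟨Real.exp (Γ * znorm z), ?_, (hone (by ring)).trans (mul_le_mul_right hle _)⟩
      have : Real.exp (Γ * znorm z) ≤ Real.exp (Γ * N) :=
        Real.exp_le_exp.2 (mul_le_mul_of_nonneg_left hN hΓ)
      linarith
  obtain ⟨s, hs, h1⟩ := hex
  calc greenE (muE μ) (posDom Λ) (1 + z) y
      ≤ (ENNReal.ofReal s * reachE (muE μ) (posDom Λ) 1 (1 + z))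
          * greenE (muE μ) (posDom Λ) (1 + z) y := by
        simpa using mul_le_mul_left h1 (greenE (muE μ) (posDom Λ) (1 + z) y)
    _ = ENNReal.ofReal s * (reachE (muE μ) (posDom Λ) 1 (1 + z)
          * greenE (muE μ) (posDom Λ) (1 + z) y) := mul_assoc _ _ _
    _ ≤ _ := mul_le_mul' (ENNReal.ofReal_le_ofReal hs) (reachE_mul_greenE_le _ _ _)

end Gradient
section Drift

variable {d : ℕ} {μ : (Fin d → ℤ) → ℝ} {r : ℝ}

lemma tsum_muE_eq_one {V : Type*} {μ : V → ℝ} (hnn : ∀ z, 0 ≤ μ z) (hsum : HasSum μ 1) :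
    ∑' z, muE μ z = 1 := by
  rw [← ENNReal.ofReal_tsum_of_nonneg hnn hsum.summable, hsum.tsum_eq, ENNReal.ofReal_one]

lemma greenE_ne_top (hnn : ∀ z, 0 ≤ μ z) {a : Fin d → ℝ} (ha : phiE μ a < 1)
    (A : Set (Fin d → ℤ)) (x y : Fin d → ℤ) : greenE (muE μ) A x y ≠ ∞ := by
  have h1 : greenE (muE μ) A x y * expE a y ≤ (1 - phiE μ a)⁻¹ * expE a x := by
    rw [greenE, ← ENNReal.tsum_mul_right, ← ENNReal.tsum_geometric, ← ENNReal.tsum_mul_right]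
    refine ENNReal.tsum_le_tsum fun n => ?_
    exact (ENNReal.le_tsum (f := fun y => kernE (muE μ) A n x y * expE a y) y).trans
      (tsum_kernE_mul_le (fun x => (tsum_step_mul_expE hnn a x).le) n x)
  have h2 : (1 - phiE μ a)⁻¹ * expE a x ≠ ∞ :=
    ENNReal.mul_ne_top (ENNReal.inv_ne_top.2 (tsub_pos_of_lt ha).ne') (expE_ne_top a x)
  intro htop
  rw [htop, ENNReal.top_mul (expE_ne_zero a y)] at h1
  exact h2 (top_le_iff.1 h1)

lemma one_add_mul_lt_rpow {ε η : ℝ} (hε : 0 < ε) (hη : 0 < η) :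
    1 + η / 2 * ε < (1 + η / 2) ^ ((1 + η) * ε) := by
  rw [← Real.log_lt_log_iff (by positivity) (by positivity), Real.log_rpow (by positivity)]
  have h1 : Real.log (1 + η / 2 * ε) ≤ η / 2 * ε := by
    have := Real.log_le_sub_one_of_pos (show 0 < 1 + η / 2 * ε by positivity)
    linarith
  have h2 := Real.one_sub_inv_le_log_of_pos (show 0 < 1 + η / 2 by positivity)
  have h3 : 1 - (1 + η / 2)⁻¹ = η / 2 / (1 + η / 2) := by field_simp; ring
  rw [h3, div_le_iff₀ (by positivity)] at h2
  refine h1.trans_lt ?_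
  have h4 : 0 < Real.log (1 + η / 2) := Real.log_pos (by linarith)
  have h5 : η / 2 < (1 + η) * Real.log (1 + η / 2) := by nlinarith
  nlinarith

lemma exists_green_shift_le (hnn : ∀ z, 0 ≤ μ z) (hsum : HasSum μ 1) (hr : 0 < r)
    (hb : Summable fun z => μ z * Real.exp (dotZ 0 z + r * znorm z)) {Λ : Set (Fin d)}
    (hirr : Irred μ (posDom Λ))
    (hfin : ∀ x y, greenE (muE μ) (posDom Λ) x y ≠ ∞) {w : Fin d → ℤ} (hw : ∀ i ∈ Λ, w i = 0)
    (hw0 : w ≠ 0) {η : ℝ} (hη : 0 < η) :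
    ∃ θ > 0, ∃ K : ℝ, ∀ x ∈ posDom Λ, ∀ y,
      green μ (posDom Λ) (x + w) y ≤ (1 + η) * green μ (posDom Λ) x y
        + K * Real.exp (θ * dotZ (Mvec μ) x) * Real.exp (-(θ * dotZ (Mvec μ) y)) := by
  have hone := tsum_muE_eq_one hnn hsum
  set A := posDom Λ with hA
  set M := Mvec μ with hM
  have hwA : ∀ x, x + w ∈ A ↔ x ∈ A := fun x =>
    forall₂_congr fun i hi => by simp [hw i hi]
  obtain ⟨k, hkpos⟩ := kernE_pos_of_irred hirr one_mem_posDom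
    ((hwA 1).2 one_mem_posDom)
  have hk : 0 < k := by
    refine Nat.pos_of_ne_zero ?_
    rintro rfl
    simp [kernE, hw0] at hkpos
  have hk1 : kernE (muE μ) A k 1 (1 + w) ≤ 1 := kernE_le_one hone.le _ _ _
  set ε := (kernE (muE μ) A k 1 (1 + w)).toReal with hεdef
  have hεE : ENNReal.ofReal ε = kernE (muE μ) A k 1 (1 + w) :=
    ENNReal.ofReal_toReal (hk1.trans_lt ENNReal.one_lt_top).ne
  have hε : 0 < ε := ENNReal.toReal_pos hkpos.ne' (hk1.trans_lt ENNReal.one_lt_top).ne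
  have hunif : ∀ x ∈ A, ENNReal.ofReal ε ≤ kernE (muE μ) A k x (x + w) := by
    intro x hx
    have := kernE_le_shift (m := muE μ) (add_mem_posDom (sub_one_nonneg_of_mem hx)) k 1 (1 + w)
    rw [show (1 : Fin d → ℤ) + (x - 1) = x by abel,
      show (1 : Fin d → ℤ) + w + (x - 1) = x + w by abel] at this
    exact hεE.le.trans this
  obtain ⟨C, hC, hphi⟩ := exists_phiE_le hnn hr hb
  set s : ℝ := 1 + η / 2 with hs
  set p : ℝ := (1 + η) * ε with hp
  set c : ℝ → ℝ := fun θ => 1 + θ * dotR M M + C * (|θ| * rnorm M) ^ 2 with hc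
  set G : ℝ → ℝ := fun θ =>
    s ^ (-p) * (c θ ^ k + (s - 1) * (ε * Real.exp (θ * dotZ M w))) with hG
  have hG0 : G 0 < 1 := by
    have h1 := one_add_mul_lt_rpow hε hη
    have h2 : 0 < s ^ p := by positivity
    simp only [hG, hc, zero_mul, abs_zero, add_zero, ne_eq, OfNat.ofNat_ne_zero, not_false_eq_true,
      zero_pow, mul_zero, one_pow, Real.exp_zero, mul_one]
    rw [Real.rpow_neg (by positivity), inv_mul_lt_iff₀ h2, mul_one]
    simpa [hs] using h1
  have hGc : Tendsto G (𝓝[>] 0) (𝓝 (G 0)) :=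
    (Continuous.tendsto (by simp only [hG, hc]; fun_prop) _).mono_left nhdsWithin_le_nhds
  have hθr : ∀ᶠ θ : ℝ in 𝓝[>] 0, |θ| * rnorm M < r / 2 := by
    have : Tendsto (fun θ : ℝ => |θ| * rnorm M) (𝓝[>] 0) (𝓝 (|0| * rnorm M)) :=
      (Continuous.tendsto (by fun_prop) _).mono_left nhdsWithin_le_nhds
    rw [abs_zero, zero_mul] at this
    exact this.eventually (gt_mem_nhds (by positivity))
  obtain ⟨θ, ⟨hθG, hθr⟩, hθ⟩ :=
    (((hGc.eventually (gt_mem_nhds hG0)).and hθr).and self_mem_nhdsWithin).exists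
  have hθ : 0 < θ := hθ
  have hMM : 0 ≤ dotR M M := Finset.sum_nonneg fun i _ => mul_self_nonneg _
  have hc0 : 0 ≤ c θ := by simp only [hc]; positivity
  have hcphi : phiE μ (θ • M) ≤ ENNReal.ofReal (c θ) := by
    have := hphi (θ • M) (by rw [rnorm_smul]; exact hθr.le)
    rw [zero_add, phiE_zero hnn hsum, gradPhi_zero, rnorm_smul, dotR_eq_dotProduct,
      smul_dotProduct] at this
    simpa [hc, dotR_eq_dotProduct] using this
  have hs1 : 1 < s := by linarith
  have key : ∀ x ∈ A, ∀ y, _ := fun x hx y =>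
    greenE_shift_le hwA hk hunif (p := p) (s := s) (by positivity) hs1
      (e := expE (θ • M)) (c := ENNReal.ofReal (c θ))
      (ω := expE (θ • M) w) (r := ENNReal.ofReal (G θ)) (x := x) (y := y)
      (fun x => (tsum_step_mul_expE hnn _ x).le.trans (mul_le_mul_left hcphi _))
      (fun x => by rw [expE_add, mul_comm])
      (le_of_eq (by
        rw [expE, dotZ_smul_left, ← ENNReal.ofReal_pow hc0, ← ENNReal.ofReal_mul hε.le,
          ← ENNReal.ofReal_mul (by linarith), ← ENNReal.ofReal_add (by positivity)
            (mul_nonneg (by linarith) (by positivity)), ← ENNReal.ofReal_mul (by positivity)]))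
      hx (expE_ne_zero _ _) (expE_ne_top _ _)
  set K₀ : ℝ≥0∞ := ENNReal.ofReal (s ^ (1 - p)) * ((1 - ENNReal.ofReal (G θ))⁻¹ *
    (∑ i ∈ Finset.range k, ENNReal.ofReal (c θ) ^ i) * ENNReal.ofReal ε * expE (θ • M) w) with hK₀
  have hK₀top : K₀ ≠ ∞ := by
    refine ENNReal.mul_ne_top ENNReal.ofReal_ne_top (ENNReal.mul_ne_top (ENNReal.mul_ne_top
      (ENNReal.mul_ne_top ?_ ?_) ENNReal.ofReal_ne_top) (expE_ne_top _ _))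
    · exact ENNReal.inv_ne_top.2 (tsub_pos_of_lt (ENNReal.ofReal_lt_one.2 hθG)).ne'
    · exact ENNReal.sum_ne_top.2 fun i _ => ENNReal.pow_ne_top ENNReal.ofReal_ne_top
  refine ⟨θ, hθ, K₀.toReal / ε, fun x hx y => ?_⟩
  have hxy := key x hx y
  have hg : ∀ x, greenE (muE μ) A x y = ENNReal.ofReal (green μ A x y) := fun x => by
    rw [green_eq_toReal hnn hone.le, ENNReal.ofReal_toReal (hfin x y)]
  have hg0 : ∀ x, 0 ≤ green μ A x y := fun x => by
    rw [green_eq_toReal hnn hone.le]; exact ENNReal.toReal_nonneg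
  have hrw : ENNReal.ofReal (s ^ (1 - p)) * ((1 - ENNReal.ofReal (G θ))⁻¹ *
      (∑ i ∈ Finset.range k, ENNReal.ofReal (c θ) ^ i) * ENNReal.ofReal ε * expE (θ • M) w *
        expE (θ • M) x) * (expE (θ • M) y)⁻¹
      = ENNReal.ofReal (K₀.toReal * Real.exp (θ * dotZ M x) * Real.exp (-(θ * dotZ M y))) := by
    have hR : ENNReal.ofReal
        (K₀.toReal * Real.exp (θ * dotZ M x) * Real.exp (-(θ * dotZ M y)))
        = K₀ * ENNReal.ofReal (Real.exp (θ * dotZ M x))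
          * ENNReal.ofReal (Real.exp (-(θ * dotZ M y))) := by
      rw [ENNReal.ofReal_mul (by positivity), ENNReal.ofReal_mul ENNReal.toReal_nonneg,
        ENNReal.ofReal_toReal hK₀top]
    rw [hR, Real.exp_neg, ENNReal.ofReal_inv_of_pos (Real.exp_pos _),
      hK₀, expE, expE, expE, dotZ_smul_left, dotZ_smul_left, dotZ_smul_left, mul_assoc _ _
        (ENNReal.ofReal (Real.exp (θ * dotZ M x)))]
    simp only [mul_assoc]
  rw [hrw, hg, hg, ← ENNReal.ofReal_mul hε.le, ← ENNReal.ofReal_mul (by positivity),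
    ← ENNReal.ofReal_add (mul_nonneg (by positivity) (hg0 x)) (by positivity),
    ENNReal.ofReal_le_ofReal_iff (add_nonneg (mul_nonneg (by positivity) (hg0 x))
      (by positivity))] at hxy
  have : green μ A (x + w) y ≤ (p * green μ A x y
      + K₀.toReal * Real.exp (θ * dotZ M x) * Real.exp (-(θ * dotZ M y))) / ε := by
    rw [le_div_iff₀ hε]
    linarith
  refine this.trans (le_of_eq ?_)
  rw [hp]
  field_simp

lemma znorm_sub_one_le (x : Fin d → ℤ) : znorm (x - 1) ≤ znorm x + d := by
  refine (znorm_le_of_abs_le (f := fun i => |(x i : ℝ)| + 1) fun i => ?_).trans ?_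
  · simpa using abs_sub (x i : ℝ) 1
  · rw [Finset.sum_add_distrib]
    simp [znorm]

lemma le_znorm_sub_one (x : Fin d → ℤ) : znorm x - d ≤ znorm (x - 1) := by
  have : znorm x ≤ ∑ i, (|((x - 1) i : ℝ)| + 1) := znorm_le_of_abs_le fun i => by
    simpa using abs_add_le ((x i : ℝ) - 1) 1
  rw [Finset.sum_add_distrib] at this
  simp only [Finset.sum_const, Finset.card_univ, Fintype.card_fin, nsmul_eq_mul, mul_one] at this
  simp only [znorm] at this ⊢
  linarith

variable {xs : ℕ → (Fin d → ℤ)}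

lemma eventually_exp_le_greenE (hnn : ∀ z, 0 ≤ μ z) (hsum : HasSum μ 1) (hr : 0 < r)
    (hb : Summable fun z => μ z * Real.exp (dotZ 0 z + r * znorm z)) (hM : Mvec μ ≠ 0)
    (hirr : Irred μ (posDom (LambdaM μ))) (hxs : ∀ n, xs n ∈ posDom (LambdaM μ))
    (hnorm : Tendsto (fun n => znorm (xs n)) atTop atTop)
    (hdir : Tendsto (fun n i => (xs n i : ℝ) / znorm (xs n)) atTop
      (𝓝 (fun i => Mvec μ i / rnorm (Mvec μ))))
    {x : Fin d → ℤ} (hx : x ∈ posDom (LambdaM μ)) {ε : ℝ} (hε : 0 < ε) :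
    ∀ᶠ n in atTop, ENNReal.ofReal (Real.exp (-(ε * znorm (xs n))))
      ≤ greenE (muE μ) (posDom (LambdaM μ)) x (xs n) := by
  have hκ : 0 < rnorm (Mvec μ) := by
    refine lt_of_le_of_ne (rnorm_nonneg _) fun h => hM (funext fun i => ?_)
    have := abs_le_rnorm (Mvec μ) i
    rw [← h] at this
    exact abs_nonpos_iff.1 this
  set ζ : Fin d → ℝ := fun i => Mvec μ i / rnorm (Mvec μ) with hζ
  obtain ⟨δ, hδ, N, hN⟩ := exists_exp_le_reachE_of_direction (Λ := LambdaM μ) hnn hirr hr hb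
    (phiE_zero hnn hsum) hκ (ζ := ζ)
    (fun i hi => by
      have : Mvec μ i = 0 := hi
      simp [hζ, this])
    (by
      rw [gradPhi_zero]
      ext i
      simp only [hζ, Pi.smul_apply, smul_eq_mul]
      field_simp)
    (ε := ε / 2) (by positivity)
  have hζ1 : ∑ i, |ζ i| = 1 := by
    simp only [hζ, abs_div, abs_of_pos hκ]
    rw [← Finset.sum_div]
    exact div_self hκ.ne'
  obtain ⟨c, hc⟩ : ∃ c : ℝ, ENNReal.ofReal (Real.exp (-c))
      ≤ reachE (muE μ) (posDom (LambdaM μ)) x 1 := by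
    obtain ⟨Γ, -, h⟩ := exists_exp_neg_le (ι := Unit)
      (f := fun _ => reachE (muE μ) (posDom (LambdaM μ)) x 1)
      fun _ => reachE_pos hirr hx one_mem_posDom
    exact ⟨Γ, h ()⟩
  have hdir' : Tendsto (fun n => ∑ i, |(xs n i : ℝ) / znorm (xs n) - ζ i|) atTop (𝓝 0) := by
    have h1 : Tendsto (fun n => ∑ i, |(xs n i : ℝ) / znorm (xs n) - ζ i|) atTop
        (𝓝 (∑ i, |ζ i - ζ i|)) :=
      tendsto_finsetSum _ fun i _ => ((tendsto_pi_nhds.1 hdir i).sub_const _).abs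
    simpa using h1
  filter_upwards [hdir'.eventually (gt_mem_nhds (show 0 < δ / 2 by positivity)),
    hnorm.eventually_ge_atTop (max (max 1 (N + d)) (max ((2 * d + δ * d) * (2 / δ))
      ((c + ε / 2 * d) * (2 / ε))))] with n hn1 hn2
  have hn3 : (1 : ℝ) ≤ znorm (xs n) := (le_max_left _ _).trans ((le_max_left _ _).trans hn2)
  have hn4 : N + d ≤ znorm (xs n) := (le_max_right _ _).trans ((le_max_left _ _).trans hn2)
  have hn5 : (2 * d + δ * d) * (2 / δ) ≤ znorm (xs n) :=
    (le_max_left _ _).trans ((le_max_right _ _).trans hn2)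
  have hn6 : (c + ε / 2 * d) * (2 / ε) ≤ znorm (xs n) :=
    (le_max_right _ _).trans ((le_max_right _ _).trans hn2)
  rw [← mul_div_assoc, div_le_iff₀ hδ] at hn5
  rw [← mul_div_assoc, div_le_iff₀ hε] at hn6
  have hpos : 0 < znorm (xs n) := by linarith
  have hle1 := znorm_sub_one_le (xs n)
  have hle2 := le_znorm_sub_one (xs n)
  have hreach := hN (xs n - 1) (sub_one_nonneg_of_mem (hxs n)) (by linarith) (by
    calc ∑ i, |((xs n - 1) i : ℝ) - znorm (xs n - 1) * ζ i|
        ≤ ∑ i, (|(xs n i : ℝ) / znorm (xs n) - ζ i| * znorm (xs n) + 1 + d * |ζ i|) := by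
          refine Finset.sum_le_sum fun i _ => ?_
          have h1 : ((xs n - 1) i : ℝ) - znorm (xs n - 1) * ζ i
              = ((xs n i : ℝ) / znorm (xs n) - ζ i) * znorm (xs n) + -1
                + (znorm (xs n) - znorm (xs n - 1)) * ζ i := by
            simp only [Pi.sub_apply, Pi.one_apply]
            push_cast
            field_simp
            ring
          rw [h1]
          refine (abs_add_three _ _ _).trans ?_
          rw [abs_mul, abs_mul, abs_of_pos hpos, abs_neg, abs_one]
          gcongr
          rw [abs_le]
          constructor <;> linarith
      _ = (∑ i, |(xs n i : ℝ) / znorm (xs n) - ζ i|) * znorm (xs n) + d + d := by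
          rw [Finset.sum_add_distrib, Finset.sum_add_distrib, ← Finset.sum_mul, ← Finset.mul_sum,
            hζ1]
          simp
      _ ≤ δ / 2 * znorm (xs n) + d + d := by gcongr
      _ ≤ δ * (znorm (xs n) - d) := by nlinarith
      _ ≤ _ := by gcongr)
  rw [add_sub_cancel, dotZ_zero] at hreach
  refine le_trans ?_ ((mul_le_mul' hc hreach).trans ((reachE_mul_le _ _ _).trans
    (reachE_le_greenE _ _)))
  rw [← ENNReal.ofReal_mul (Real.exp_pos _).le, ← Real.exp_add]
  refine ENNReal.ofReal_le_ofReal (Real.exp_le_exp.2 ?_)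
  nlinarith

end Drift
section Martin

variable {d : ℕ} {μ : (Fin d → ℤ) → ℝ} {r : ℝ} {xs : ℕ → (Fin d → ℤ)}

lemma green_nonneg {V : Type*} [AddCommGroup V] {μ : V → ℝ} (hnn : ∀ z, 0 ≤ μ z)
    (hsum : HasSum μ 1) (A : Set V) (x y : V) : 0 ≤ green μ A x y := by
  rw [green_eq_toReal hnn (tsum_muE_eq_one hnn hsum).le]
  exact ENNReal.toReal_nonneg

lemma exists_mul_znorm_le_dotZ (hM : Mvec μ ≠ 0)
    (hnorm : Tendsto (fun n => znorm (xs n)) atTop atTop)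
    (hdir : Tendsto (fun n i => (xs n i : ℝ) / znorm (xs n)) atTop
      (𝓝 (fun i => Mvec μ i / rnorm (Mvec μ)))) :
    ∃ c > 0, ∀ᶠ n in atTop, c * znorm (xs n) ≤ dotZ (Mvec μ) (xs n) := by
  have hMM : 0 < Mvec μ ⬝ᵥ Mvec μ := dotProduct_self_pos_of_ne_zero hM
  have hκ : 0 < rnorm (Mvec μ) := by
    refine lt_of_le_of_ne (rnorm_nonneg _) fun h => hM (funext fun i => ?_)
    have := abs_le_rnorm (Mvec μ) i
    rw [← h] at this
    exact abs_nonpos_iff.1 this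
  have h1 : Tendsto (fun n => ∑ i, Mvec μ i * ((xs n i : ℝ) / znorm (xs n))) atTop
      (𝓝 (∑ i, Mvec μ i * (Mvec μ i / rnorm (Mvec μ)))) :=
    tendsto_finsetSum _ fun i _ => (tendsto_pi_nhds.1 hdir i).const_mul _
  have h2 : ∑ i, Mvec μ i * (Mvec μ i / rnorm (Mvec μ))
      = Mvec μ ⬝ᵥ Mvec μ / rnorm (Mvec μ) := by
    simp only [← mul_div_assoc]
    rw [← Finset.sum_div]
    rfl
  rw [h2] at h1
  have hlt : Mvec μ ⬝ᵥ Mvec μ / rnorm (Mvec μ) / 2 < Mvec μ ⬝ᵥ Mvec μ / rnorm (Mvec μ) :=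
    half_lt_self (by positivity)
  refine ⟨_, (by positivity : 0 < Mvec μ ⬝ᵥ Mvec μ / rnorm (Mvec μ) / 2), ?_⟩
  filter_upwards [h1.eventually (lt_mem_nhds hlt), hnorm.eventually_gt_atTop 0] with n hn hpos
  have h3 : ∑ i, Mvec μ i * ((xs n i : ℝ) / znorm (xs n))
      = dotZ (Mvec μ) (xs n) / znorm (xs n) := by
    simp only [← mul_div_assoc]
    rw [← Finset.sum_div]
    rfl
  rw [h3, lt_div_iff₀ hpos] at hn
  exact hn.le

lemma le_of_tendsto_green_shift (hnn : ∀ z, 0 ≤ μ z) (hsum : HasSum μ 1) (hr : 0 < r)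
    (hb : Summable fun z => μ z * Real.exp (dotZ 0 z + r * znorm z)) (hM : Mvec μ ≠ 0)
    (hirr : Irred μ (posDom (LambdaM μ)))
    (hfin : ∀ x y, greenE (muE μ) (posDom (LambdaM μ)) x y ≠ ∞)
    (hxs : ∀ n, xs n ∈ posDom (LambdaM μ))
    (hnorm : Tendsto (fun n => znorm (xs n)) atTop atTop)
    (hdir : Tendsto (fun n i => (xs n i : ℝ) / znorm (xs n)) atTop
      (𝓝 (fun i => Mvec μ i / rnorm (Mvec μ))))
    {x₀ x w : Fin d → ℤ} (hx₀ : x₀ ∈ posDom (LambdaM μ)) (hx : x ∈ posDom (LambdaM μ))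
    (hw : ∀ i ∈ LambdaM μ, w i = 0) {a a' : ℝ}
    (ha : Tendsto (fun n => green μ (posDom (LambdaM μ)) x (xs n)
      / green μ (posDom (LambdaM μ)) x₀ (xs n)) atTop (𝓝 a))
    (ha' : Tendsto (fun n => green μ (posDom (LambdaM μ)) (x + w) (xs n)
      / green μ (posDom (LambdaM μ)) x₀ (xs n)) atTop (𝓝 a')) : a' ≤ a := by
  rcases eq_or_ne w 0 with rfl | hw0
  · rw [add_zero] at ha'
    exact (tendsto_nhds_unique ha' ha).le
  have hη : ∀ η > 0, a' ≤ (1 + η) * a := by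
    intro η hη
    obtain ⟨θ, hθ, K, hK⟩ := exists_green_shift_le hnn hsum hr hb hirr hfin hw hw0 hη
    obtain ⟨c, hc, hcM⟩ := exists_mul_znorm_le_dotZ hM hnorm hdir
    have hlow := eventually_exp_le_greenE hnn hsum hr hb hM hirr hxs hnorm hdir hx₀
      (ε := θ * c / 2) (by positivity)
    set K' := |K * Real.exp (θ * dotZ (Mvec μ) x)| with hK'
    have hlim : Tendsto (fun n => (1 + η) * (green μ (posDom (LambdaM μ)) x (xs n)
        / green μ (posDom (LambdaM μ)) x₀ (xs n))
        + K' * Real.exp (-(θ * c / 2 * znorm (xs n)))) atTop (𝓝 ((1 + η) * a + K' * 0)) := by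
      refine (ha.const_mul _).add (Tendsto.const_mul _ ?_)
      exact Real.tendsto_exp_neg_atTop_nhds_zero.comp (hnorm.const_mul_atTop (by positivity))
    rw [mul_zero, add_zero] at hlim
    refine le_of_tendsto_of_tendsto ha' hlim ?_
    filter_upwards [hcM, hlow] with n hn1 hn2
    have hg : Real.exp (-(θ * c / 2 * znorm (xs n)))
        ≤ green μ (posDom (LambdaM μ)) x₀ (xs n) := by
      rw [green_eq_toReal hnn (tsum_muE_eq_one hnn hsum).le]
      exact (ENNReal.ofReal_le_iff_le_toReal (hfin _ _)).1 hn2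
    have hgpos := (Real.exp_pos _).trans_le hg
    rw [div_le_iff₀ hgpos, add_mul, mul_assoc, div_mul_cancel₀ _ hgpos.ne']
    refine (hK x hx (xs n)).trans (add_le_add_right ?_ _)
    calc K * Real.exp (θ * dotZ (Mvec μ) x) * Real.exp (-(θ * dotZ (Mvec μ) (xs n)))
        ≤ K' * Real.exp (-(θ * (c * znorm (xs n)))) := by
          gcongr
          exact le_abs_self _
      _ = K' * Real.exp (-(θ * c / 2 * znorm (xs n)))
            * Real.exp (-(θ * c / 2 * znorm (xs n))) := by
          rw [mul_assoc, ← Real.exp_add]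
          congr 2
          ring
      _ ≤ _ := by gcongr
  have hlim : Tendsto (fun η : ℝ => (1 + η) * a) (𝓝[>] 0) (𝓝 ((1 + 0) * a)) :=
    (Continuous.tendsto (by fun_prop) _).mono_left nhdsWithin_le_nhds
  rw [add_zero, one_mul] at hlim
  exact ge_of_tendsto hlim (eventually_nhdsWithin_of_forall hη)

lemma summable_mul_exp_shift (hnn : ∀ z, 0 ≤ μ z) (hr : 0 ≤ r) {b : Fin d → ℝ}
    (hb : Summable fun z => μ z * Real.exp (dotZ b z + r * znorm z)) (x v : Fin d → ℤ) :
    Summable fun z => μ (z - x) * Real.exp (dotZ b (z - v) + r * znorm (z - v)) := by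
  rw [← (Equiv.addRight x).summable_iff]
  refine Summable.of_nonneg_of_le (fun z => mul_nonneg (hnn _) (Real.exp_pos _).le) (fun z => ?_)
    (hb.mul_right (Real.exp (dotZ b (x - v) + r * znorm (x - v))))
  simp only [Function.comp_apply, Equiv.coe_addRight, add_sub_cancel_right]
  rw [mul_assoc, ← Real.exp_add]
  refine mul_le_mul_of_nonneg_left (Real.exp_le_exp.2 ?_) (hnn z)
  rw [add_sub_assoc, dotZ_add_right]
  have : znorm (z + (x - v)) ≤ znorm z + znorm (x - v) := by
    refine (znorm_le_of_abs_le (f := fun i => |(z i : ℝ)| + |((x - v) i : ℝ)|) fun i => ?_).trans ?_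
    · rw [Pi.add_apply, Int.cast_add]
      exact abs_add_le _ _
    · rw [Finset.sum_add_distrib]
      rfl
  have := mul_le_mul_of_nonneg_left this hr
  linarith

lemma hasSum_mul_of_tendsto_green (hnn : ∀ z, 0 ≤ μ z) (hsum : HasSum μ 1) (hA1 : A1 μ)
    (hr : 0 < r) (hb : ∀ b ∈ Dset μ, Summable fun z => μ z * Real.exp (dotZ b z + r * znorm z))
    (hM : Mvec μ ≠ 0) {Λ : Set (Fin d)} (hfin : ∀ x y, greenE (muE μ) (posDom Λ) x y ≠ ∞)
    (hnorm : Tendsto (fun n => znorm (xs n)) atTop atTop)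
    {x₀ : Fin d → ℤ} {h : (Fin d → ℤ) → ℝ}
    (hh : ∀ x ∈ posDom Λ, Tendsto (fun n => green μ (posDom Λ) x (xs n)
      / green μ (posDom Λ) x₀ (xs n)) atTop (𝓝 (h x)))
    {x : Fin d → ℤ} (hx : x ∈ posDom Λ) :
    HasSum (fun z => if z ∈ posDom Λ then μ (z - x) * h z else 0) (h x) := by
  have hone := tsum_muE_eq_one hnn hsum
  have hgn := green_nonneg hnn hsum (posDom Λ)
  obtain ⟨B, hB, c, hbd⟩ := exists_greenE_le (Λ := Λ) hnn hsum hA1 hr hb hM hr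
  set W : (Fin d → ℤ) → ℝ := fun z =>
    Real.exp c + ∑ b ∈ B, Real.exp (dotZ b (z - 1) + r * znorm (z - 1)) with hW
  have hW0 : ∀ z, 0 ≤ W z := fun z =>
    add_nonneg (Real.exp_pos _).le (Finset.sum_nonneg fun _ _ => (Real.exp_pos _).le)
  have hgW : ∀ z ∈ posDom Λ, ∀ y,
      green μ (posDom Λ) z y ≤ W z * green μ (posDom Λ) 1 y := by
    intro z hz y
    have h1 := hbd (z - 1) (sub_one_nonneg_of_mem hz) y
    rw [add_sub_cancel] at h1
    have h2 := ENNReal.toReal_mono (ENNReal.mul_ne_top ENNReal.ofReal_ne_top (hfin 1 y)) h1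
    rw [ENNReal.toReal_mul, ENNReal.toReal_ofReal (hW0 z)] at h2
    rwa [green_eq_toReal hnn hone.le, green_eq_toReal hnn hone.le]
  have hWsum : Summable fun z => μ (z - x) * W z * (h 1 + 1) := by
    refine Summable.mul_right _ ?_
    simp only [hW, mul_add, Finset.mul_sum]
    refine Summable.add (((Equiv.subRight x).summable_iff.2 hsum.summable).mul_right _) ?_
    exact summable_sum fun b hbB => summable_mul_exp_shift hnn hr.le (hb b (hB b hbB)) x 1
  have hdom : ∀ᶠ n in atTop, ∀ z,
      ‖if z ∈ posDom Λ then μ (z - x) * (green μ (posDom Λ) z (xs n)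
        / green μ (posDom Λ) x₀ (xs n)) else 0‖ ≤ μ (z - x) * W z * (h 1 + 1) := by
    filter_upwards [(hh 1 one_mem_posDom).eventually (gt_mem_nhds (lt_add_one (h 1)))]
      with n hn z
    have hn0 : 0 ≤ h 1 + 1 := (div_nonneg (hgn _ _) (hgn _ _)).trans hn.le
    split_ifs with hz
    · rw [Real.norm_of_nonneg (mul_nonneg (hnn _) (div_nonneg (hgn _ _) (hgn _ _))), mul_assoc]
      refine mul_le_mul_of_nonneg_left ?_ (hnn _)
      calc _ ≤ W z * green μ (posDom Λ) 1 (xs n) / green μ (posDom Λ) x₀ (xs n) :=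
            div_le_div_of_nonneg_right (hgW z hz _) (hgn _ _)
        _ = W z * (green μ (posDom Λ) 1 (xs n) / green μ (posDom Λ) x₀ (xs n)) :=
            mul_div_assoc _ _ _
        _ ≤ _ := mul_le_mul_of_nonneg_left hn.le (hW0 z)
    · rw [norm_zero]
      exact mul_nonneg (mul_nonneg (hnn _) (hW0 _)) hn0
  have hlim := tendsto_tsum_of_dominated_convergence
    (g := fun z => if z ∈ posDom Λ then μ (z - x) * h z else 0) hWsum (fun z => by
      split_ifs with hz
      · exact (hh z hz).const_mul _
      · exact tendsto_const_nhds) hdom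
  have heq : ∀ᶠ n in atTop, ∑' z, (if z ∈ posDom Λ then μ (z - x) *
      (green μ (posDom Λ) z (xs n) / green μ (posDom Λ) x₀ (xs n)) else 0)
      = green μ (posDom Λ) x (xs n) / green μ (posDom Λ) x₀ (xs n) := by
    filter_upwards [hnorm.eventually_gt_atTop (znorm x)] with n hn
    have hne : x ≠ xs n := by
      rintro rfl
      exact lt_irrefl _ hn
    have h1 := congrArg ENNReal.toReal (greenE_eq (m := muE μ) hx hne)
    rw [ENNReal.tsum_toReal_eq fun z =>
      ENNReal.mul_ne_top ENNReal.ofReal_ne_top (hfin _ _)] at h1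
    rw [green_eq_toReal hnn hone.le x, h1, ← tsum_div_const]
    refine tsum_congr fun z => ?_
    rw [ENNReal.toReal_mul, ENNReal.toReal_ofReal (hnn _), mul_div_assoc,
      ← green_eq_toReal hnn hone.le z]
    split_ifs with hz
    · rfl
    · have : green μ (posDom Λ) z (xs n) = 0 := by
        rw [green_eq_toReal hnn hone.le, greenE]
        simp [kernE_left_notMem hz]
      rw [this, zero_div, mul_zero]
  have hval := tendsto_nhds_unique (hlim.congr' heq) (hh x hx)
  rw [← hval]
  have hle : ∀ z, ‖if z ∈ posDom Λ then μ (z - x) * h z else 0‖ ≤ μ (z - x) * W z * (h 1 + 1) :=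
    fun z => by
      refine le_of_tendsto (Tendsto.norm ?_) (hdom.mono fun n hn => hn z)
      split_ifs with hz
      · exact (hh z hz).const_mul _
      · exact tendsto_const_nhds
  exact (Summable.of_norm_bounded hWsum hle).hasSum

/-- Extension of a vector of `ℤ^Λ` to a vector of `ℤ^d` by `1`. -/
def liftL (Λ : Set (Fin d)) (u : ↥Λ → ℤ) : Fin d → ℤ :=
  fun i => if hi : i ∈ Λ then u ⟨i, hi⟩ else 1

lemma projL_liftL (Λ : Set (Fin d)) (u : ↥Λ → ℤ) : projL Λ (liftL Λ u) = u := by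
  ext ⟨i, hi⟩
  simp [projL, liftL, hi]

lemma projL_mem_posL {Λ : Set (Fin d)} {x : Fin d → ℤ} : projL Λ x ∈ posL Λ ↔ x ∈ posDom Λ :=
  ⟨fun h i hi => h ⟨i, hi⟩, fun h i => h i.1 i.2⟩

lemma liftL_mem_posDom {Λ : Set (Fin d)} {u : ↥Λ → ℤ} (hu : u ∈ posL Λ) :
    liftL Λ u ∈ posDom Λ := by
  rwa [← projL_mem_posL, projL_liftL]

lemma eq_liftL_projL_of_shift_le {Λ : Set (Fin d)} {h : (Fin d → ℤ) → ℝ}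
    (hle : ∀ x ∈ posDom Λ, ∀ w, (∀ i ∈ Λ, w i = 0) → h (x + w) ≤ h x) {x : Fin d → ℤ}
    (hx : x ∈ posDom Λ) : h (liftL Λ (projL Λ x)) = h x := by
  have hw : ∀ i ∈ Λ, (liftL Λ (projL Λ x) - x) i = 0 := fun i hi => by
    simp [liftL, projL, hi]
  have h1 := hle x hx _ hw
  have h2 := hle (liftL Λ (projL Λ x)) (liftL_mem_posDom (projL_mem_posL.2 hx))
    (x - liftL Λ (projL Λ x)) fun i hi => by
      have := hw i hi
      simp only [Pi.sub_apply] at this ⊢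
      lia
  rw [add_sub_cancel] at h1 h2
  exact le_antisymm h1 h2

lemma harmOn_comp_liftL {Λ : Set (Fin d)} {h : (Fin d → ℤ) → ℝ}
    (hharm : ∀ x ∈ posDom Λ, HasSum (fun z => if z ∈ posDom Λ then μ (z - x) * h z else 0) (h x))
    (hproj : ∀ x ∈ posDom Λ, h (liftL Λ (projL Λ x)) = h x) :
    HarmOn (muL μ Λ) (posL Λ) fun u => h (liftL Λ u) := by
  intro u hu
  have h1 := (hharm _ (liftL_mem_posDom hu)).tsum_fiberwise (projL Λ)
  refine h1.tsum_eq.symm.trans (tsum_congr fun v => ?_)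
  have h2 := tsum_subtype (projL Λ ⁻¹' {v})
    (fun z => if z ∈ posDom Λ then μ (z - liftL Λ u) * h z else 0)
  refine Eq.trans h2 ?_
  have h3 : (projL Λ ⁻¹' {v}).indicator
      (fun z => if z ∈ posDom Λ then μ (z - liftL Λ u) * h z else 0)
      = fun z => (if projL Λ z = v then μ (z - liftL Λ u) else 0)
        * (if v ∈ posL Λ then h (liftL Λ v) else 0) := by
    funext z
    rw [Set.indicator_apply]
    by_cases hz : projL Λ z = v
    · subst hz
      by_cases hzA : z ∈ posDom Λ
      · simp [hzA, projL_mem_posL.2 hzA, hproj z hzA]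
      · simp [hzA, projL_mem_posL]
    · simp [hz]
  rw [h3, tsum_mul_right, muL]
  have h4 : ∑' z, (if projL Λ z = v then μ (z - liftL Λ u) else 0)
      = ∑' z, if projL Λ z = v - u then μ z else 0 := by
    rw [← (Equiv.addRight (liftL Λ u)).tsum_eq]
    refine tsum_congr fun z => ?_
    have : projL Λ (z + liftL Λ u) = projL Λ z + u := by
      conv_rhs => rw [← projL_liftL Λ u]
      rfl
    simp [this, eq_sub_iff_add_eq]
  rw [h4]
  split_ifs <;> simp

end Martin

end

theorem statement14 {d : ℕ} (μ : (Fin d → ℤ) → ℝ)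
    (hnn : ∀ z, 0 ≤ μ z) (hsum : HasSum μ 1)
    (hA1 : A1 μ) (hA2 : A2 μ) (hA3 : A3 μ)
    (x₀ : Fin d → ℤ) (hx₀ : x₀ ∈ posDom (LambdaM μ))
    (xs : ℕ → (Fin d → ℤ)) (hxs : ∀ n, xs n ∈ posDom (LambdaM μ))
    (hnorm : Tendsto (fun n => znorm (xs n)) atTop atTop)
    (hdir : Tendsto (fun n i => (xs n i : ℝ) / znorm (xs n)) atTop
      (𝓝 (fun i => Mvec μ i / rnorm (Mvec μ))))
    (hfund : Fundamental μ (posDom (LambdaM μ)) x₀ xs) :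
    ∃ f : (↥(LambdaM μ) → ℤ) → ℝ,
      (∀ u ∈ posL (LambdaM μ), 0 < f u) ∧
      HarmOn (muL μ (LambdaM μ)) (posL (LambdaM μ)) f ∧
      ∀ x ∈ posDom (LambdaM μ),
        Tendsto (fun n =>
            green μ (posDom (LambdaM μ)) x (xs n) / green μ (posDom (LambdaM μ)) x₀ (xs n))
          atTop (𝓝 (f (projL (LambdaM μ) x) / f (projL (LambdaM μ) x₀))) := by
  obtain ⟨r, hr, hb⟩ := exists_expMoment hnn (hA1 ∅) hA2
  have hb0 := hb 0 (phiE_zero hnn hsum).le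
  obtain ⟨a, ha⟩ := exists_phiE_smul_lt_one hnn hsum hr hb0 hA3
  set Λ := LambdaM μ with hΛ
  have hfin := greenE_ne_top hnn ha (posDom Λ)
  have hgreen := green_eq_toReal (A := posDom Λ) hnn (tsum_muE_eq_one hnn hsum).le
  have hreach : ∀ x ∈ posDom Λ, ∀ y ∈ posDom Λ, 0 < (reachE (muE μ) (posDom Λ) x y).toReal :=
    fun x hx y hy => ENNReal.toReal_pos (reachE_pos (hA1 Λ) hx hy).ne'
      (ne_top_of_le_ne_top (hfin x y) (reachE_le_greenE x y))
  have hpos : ∀ n, 0 < green μ (posDom Λ) x₀ (xs n) := fun n => by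
    rw [hgreen]
    exact (hreach x₀ hx₀ _ (hxs n)).trans_le
      (ENNReal.toReal_mono (hfin _ _) (reachE_le_greenE _ _))
  choose! h hh using hfund
  have hle : ∀ x ∈ posDom Λ, ∀ w, (∀ i ∈ Λ, w i = 0) → h (x + w) ≤ h x := fun x hx w hw =>
    le_of_tendsto_green_shift hnn hsum hr hb0 hA3 (hA1 Λ) hfin hxs hnorm hdir hx₀ hx hw
      (hh x hx) (hh (x + w) fun i hi => by rw [Pi.add_apply, hw i hi, add_zero]; exact hx i hi)
  have hproj : ∀ x ∈ posDom Λ, h (liftL Λ (projL Λ x)) = h x :=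
    fun x hx => eq_liftL_projL_of_shift_le hle hx
  have hone : h x₀ = 1 := by
    refine tendsto_nhds_unique (hh x₀ hx₀) ?_
    simp only [div_self (hpos _).ne']
    exact tendsto_const_nhds
  refine ⟨fun u => h (liftL Λ u), fun u hu => ?_, harmOn_comp_liftL (fun x hx =>
    hasSum_mul_of_tendsto_green hnn hsum hA1 hr hb hA3 hfin hnorm hh hx) hproj, fun x hx => ?_⟩
  · have hu' := liftL_mem_posDom hu
    refine (hreach _ hu' x₀ hx₀).trans_le
      (ge_of_tendsto (hh _ hu') (Eventually.of_forall fun n => ?_))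
    rw [le_div_iff₀ (hpos n), hgreen, hgreen, ← ENNReal.toReal_mul]
    exact ENNReal.toReal_mono (hfin _ _) (reachE_mul_greenE_le _ _ _)
  · simp only [hproj x hx, hproj x₀ hx₀, hone, div_one]
    exact hh x hx
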